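/- arXiv:2011.03087 — 8 statements merged into one kernel-verified Lean document; each statement's English description precedes it below -/
import Mathlib

section
/- Let G be a finite simple graph, g : V(G) → ℝ≥0 a function, γ a g-factor of G, and α a minimal forcing function for γ (α ⇑ γ). Then for every edge e ∈ E(G), either α(e) = 0 or α(e) = γ(e). -/
open Finset

variable {V : Type} [Fintype V] [DecidableEq V]

/-- The sum of `γ` over the edges of `G` incident with the vertex `v`.
(Functions on `E(G)` are encoded as functions on `Sym2 V` vanishing off the edge set.) -/
def vertexSum (G : SimpleGraph V) [DecidableRel G.Adj] (γ : Sym2 V → ℝ) (v : V) : ℝ :=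
  ∑ e ∈ G.edgeFinset, if v ∈ e then γ e else 0

/-- `γ` is a `g`-factor of `G`: nonnegative on edges, zero off `E(G)`, and the sum over the
edges incident with any vertex `v` equals `g v`. -/
def IsGFactor (G : SimpleGraph V) [DecidableRel G.Adj] (g : V → ℝ) (γ : Sym2 V → ℝ) : Prop :=
  (∀ e, 0 ≤ γ e) ∧ (∀ e ∉ G.edgeSet, γ e = 0) ∧ ∀ v, vertexSum G γ v = g v

/-- `α ↑ γ` : `α` is a forcing function for the `g`-factor `γ`, i.e. `α` is a nonnegative
function on the edges with `α ⪯ γ`, and `γ` is the unique `g`-factor `γ'` with `α ⪯ γ'`. -/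
def IsGForcing (G : SimpleGraph V) [DecidableRel G.Adj] (g : V → ℝ)
    (α γ : Sym2 V → ℝ) : Prop :=
  (∀ e, 0 ≤ α e) ∧ (∀ e ∉ G.edgeSet, α e = 0) ∧ α ≤ γ ∧
    ∀ γ', IsGFactor G g γ' → α ≤ γ' → γ' = γ

/-- `α ⇑ γ` : `α` is a minimal forcing function for the `g`-factor `γ`. -/
def IsGMinForcing (G : SimpleGraph V) [DecidableRel G.Adj] (g : V → ℝ)
    (α γ : Sym2 V → ℝ) : Prop :=
  IsGForcing G g α γ ∧
    ∀ α', (∀ e, 0 ≤ α' e) → α' ≤ α → IsGForcing G g α' γ → α' = α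

theorem vertexSum_lineMap (G : SimpleGraph V) [DecidableRel G.Adj] (γ γ' : Sym2 V → ℝ) (t : ℝ)
    (v : V) : vertexSum G (fun f => (1 - t) * γ f + t * γ' f) v =
      (1 - t) * vertexSum G γ v + t * vertexSum G γ' v := by
  simp only [vertexSum, Finset.mul_sum, ← Finset.sum_add_distrib]
  refine Finset.sum_congr rfl fun f _ => ?_
  split_ifs <;> simp

/-- The set of `g`-factors is convex. -/
theorem IsGFactor.lineMap {G : SimpleGraph V} [DecidableRel G.Adj] {g : V → ℝ}
    {γ γ' : Sym2 V → ℝ} (hγ : IsGFactor G g γ) (hγ' : IsGFactor G g γ') {t : ℝ}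
    (ht0 : 0 ≤ t) (ht1 : t ≤ 1) : IsGFactor G g (fun f => (1 - t) * γ f + t * γ' f) := by
  refine ⟨fun f => ?_, fun f hf => ?_, fun v => ?_⟩
  · exact add_nonneg (mul_nonneg (sub_nonneg.2 ht1) (hγ.1 f)) (mul_nonneg ht0 (hγ'.1 f))
  · simp [hγ.2.1 f hf, hγ'.2.1 f hf]
  · rw [vertexSum_lineMap, hγ.2.2, hγ'.2.2]
    ring

/-- Lowering a forcing function to `0` on an edge where it is not saturated keeps it forcing. -/
theorem IsGForcing.update_zero {G : SimpleGraph V} [DecidableRel G.Adj] {g : V → ℝ}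
    {α γ : Sym2 V → ℝ} (hα : IsGForcing G g α γ) (hγ : IsGFactor G g γ) {e : Sym2 V}
    (he : α e < γ e) : IsGForcing G g (Function.update α e 0) γ := by
  obtain ⟨h0, hoff, hle, huniq⟩ := hα
  have hpos : 0 < γ e := (h0 e).trans_lt he
  refine ⟨fun f => ?_, fun f hf => ?_, fun f => ?_, fun γ' hγ' hle' => ?_⟩
  · rcases eq_or_ne f e with rfl | hf <;> simp [*]
  · rcases eq_or_ne f e with rfl | hfe <;> simp [*]
  · rcases eq_or_ne f e with rfl | hf
    · simpa using hpos.le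
    · simpa [hf] using hle f
  obtain ⟨t, ht⟩ : ∃ t, t = (γ e - α e) / γ e := ⟨_, rfl⟩
  have ht0 : 0 < t := ht ▸ div_pos (sub_pos.2 he) hpos
  have ht1 : t ≤ 1 := ht ▸ (div_le_one hpos).2 (sub_le_self _ (h0 e))
  have hte : t * γ e = γ e - α e := by rw [ht, div_mul_cancel₀ _ hpos.ne']
  have key := huniq _ (hγ.lineMap hγ' ht0.le ht1) fun f => by
    rcases eq_or_ne f e with rfl | hf
    · change α f ≤ (1 - t) * γ f + t * γ' f
      linarith [mul_nonneg ht0.le (hγ'.1 f)]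
    · have h : α f ≤ γ' f := by simpa [hf] using hle' f
      change α f ≤ (1 - t) * γ f + t * γ' f
      linarith [mul_le_mul_of_nonneg_left h ht0.le,
        mul_le_mul_of_nonneg_left (hle f) (sub_nonneg.2 ht1)]
  funext f
  have hf : (1 - t) * γ f + t * γ' f = γ f := congrFun key f
  exact mul_left_cancel₀ ht0.ne' (by linarith)

/-- Saturated edges lemma: if `α ⇑ γ` then on every edge, `α` is `0` or agrees with `γ`. -/
theorem minForcing_saturated (G : SimpleGraph V) [DecidableRel G.Adj]
    (g : V → ℝ) (hg : ∀ v, 0 ≤ g v) (γ : Sym2 V → ℝ) (hγ : IsGFactor G g γ)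
    (α : Sym2 V → ℝ) (hα : IsGMinForcing G g α γ) :
    ∀ e ∈ G.edgeSet, α e = 0 ∨ α e = γ e := by
  intro e _
  by_contra! h
  have hforce := hα.1.update_zero hγ ((hα.1.2.2.1 e).lt_of_ne h.2)
  have hzero := hα.2 _ hforce.1 (update_le_iff.2 ⟨hα.1.1 e, fun _ _ => le_rfl⟩) hforce
  exact h.1 (by simpa using (congrFun hzero e).symm)
end

section
/- Let G be a finite simple graph, g : V(G) → ℝ≥0 a function, and γ, γ' two g-factors of G with supp(γ) = supp(γ'). Suppose α is a minimal forcing function for γ (α ⇑ γ). Define α' : E(G) → ℝ by α'(e) = γ'(e) whenever α(e) = γ(e), and α'(e) = 0 otherwise. Then α' is a minimal forcing function for γ' (α' ⇑ γ'). -/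
open Finset

variable {V : Type} [Fintype V] [DecidableEq V]

/-- Moving from `γ` along a multiple of the difference of two `g`-factors preserves the
vertex sums. -/
lemma vertexSum_add_mul_sub (G : SimpleGraph V) [DecidableRel G.Adj]
    (γ δ δ' : Sym2 V → ℝ) (ε : ℝ) (v : V) :
    vertexSum G (fun e => γ e + ε * (δ e - δ' e)) v =
      vertexSum G γ v + ε * (vertexSum G δ v - vertexSum G δ' v) := by
  simp only [vertexSum, ← Finset.sum_sub_distrib, Finset.mul_sum, ← Finset.sum_add_distrib]
  refine Finset.sum_congr rfl fun e _ => ?_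
  split_ifs <;> simp

/-- If `a ≤ c` pointwise on a finite type and `h` is nonnegative wherever `a = c`, then a small
positive multiple of `h` can be added to `c` while staying above `a`. -/
lemma exists_pos_le_add_mul {ι : Type*} [Finite ι] {a c h : ι → ℝ} (hac : a ≤ c)
    (hh : ∀ i, a i = c i → 0 ≤ h i) : ∃ ε : ℝ, 0 < ε ∧ ∀ i, a i ≤ c i + ε * h i := by
  have key : ∀ᶠ ε : ℝ in nhdsWithin 0 (Set.Ioi 0), ∀ i, a i ≤ c i + ε * h i := by
    refine Filter.eventually_all.2 fun i => ?_
    rcases (hac i).eq_or_lt with hi | hi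
    · filter_upwards [self_mem_nhdsWithin] with ε hε
      have := mul_nonneg (le_of_lt (Set.mem_Ioi.1 hε)) (hh i hi)
      linarith
    · have hc : Continuous fun ε : ℝ => c i + ε * h i := by fun_prop
      have ht := hc.tendsto 0
      rw [zero_mul, add_zero] at ht
      exact ((ht.eventually_const_lt hi).filter_mono nhdsWithin_le_nhds).mono fun _ => le_of_lt
  obtain ⟨ε, hε, hpos⟩ := (key.and self_mem_nhdsWithin).exists
  exact ⟨ε, hpos, hε⟩

/-- Whether a function forces a `g`-factor depends only on the set of edges on which the two
agree, and this dependence is monotone and independent of the `g`-factor. -/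
lemma IsGForcing.transfer {G : SimpleGraph V} [DecidableRel G.Adj] {g : V → ℝ}
    {α γ α' γ' : Sym2 V → ℝ} (hα : IsGForcing G g α γ) (hγ : IsGFactor G g γ)
    (hγ' : IsGFactor G g γ') (hnonneg : ∀ e, 0 ≤ α' e) (hle : α' ≤ γ')
    (hagree : ∀ e, α e = γ e → α' e = γ' e) : IsGForcing G g α' γ' := by
  obtain ⟨hα0, -, hαγ, huniq⟩ := hα
  refine ⟨hnonneg, fun e he => le_antisymm ((hle e).trans_eq (hγ'.2.1 e he)) (hnonneg e), hle,
    fun δ hδ hαδ => ?_⟩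
  obtain ⟨ε, hε, hb⟩ := exists_pos_le_add_mul (h := fun e => δ e - γ' e) hαγ
    fun e he => sub_nonneg.2 (hagree e he ▸ hαδ e)
  have heq := huniq (fun e => γ e + ε * (δ e - γ' e))
    ⟨fun e => (hα0 e).trans (hb e),
      fun e he => by simp [hγ.2.1 e he, hδ.2.1 e he, hγ'.2.1 e he],
      fun v => by rw [vertexSum_add_mul_sub, hγ.2.2, hδ.2.2, hγ'.2.2]; ring⟩ hb
  funext e
  have he : ε * (δ e - γ' e) = 0 := by simpa using congrFun heq e
  exact sub_eq_zero.1 ((mul_eq_zero.1 he).resolve_left hε.ne')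

/-- If `γ, γ'` are `g`-factors with the same support and `α ⇑ γ`, then the function `α'`
which agrees with `γ'` wherever `α` agrees with `γ` and is `0` elsewhere satisfies `α' ⇑ γ'`. -/
theorem minForcing_transfer (G : SimpleGraph V) [DecidableRel G.Adj]
    (g : V → ℝ) (hg : ∀ v, 0 ≤ g v) (γ γ' : Sym2 V → ℝ)
    (hγ : IsGFactor G g γ) (hγ' : IsGFactor G g γ')
    (hsupp : {e | γ e ≠ 0} = {e | γ' e ≠ 0})
    (α : Sym2 V → ℝ) (hα : IsGMinForcing G g α γ)
    (α' : Sym2 V → ℝ)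
    (hα' : ∀ e, (α e = γ e → α' e = γ' e) ∧ (α e ≠ γ e → α' e = 0)) :
    IsGMinForcing G g α' γ' := by
  classical
  obtain ⟨hforce, hmin⟩ := hα
  have hzero : ∀ e, γ e = 0 ↔ γ' e = 0 := fun e =>
    not_iff_not.1 (Set.ext_iff.1 hsupp e)
  have hα'0 : ∀ e, 0 ≤ α' e := fun e => by
    by_cases h : α e = γ e
    · exact ((hα' e).1 h).symm ▸ hγ'.1 e
    · exact ((hα' e).2 h).ge
  have hα'le : α' ≤ γ' := fun e => by
    by_cases h : α e = γ e
    · exact ((hα' e).1 h).le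
    · exact ((hα' e).2 h).symm ▸ hγ'.1 e
  have hagree : ∀ e, α' e = γ' e → α e = γ e := fun e he => by
    by_contra h
    have hγe : γ e = 0 := (hzero e).2 (he ▸ (hα' e).2 h)
    exact h (le_antisymm (hforce.2.2.1 e) (hγe ▸ hforce.1 e))
  refine ⟨hforce.transfer hγ hγ' hα'0 hα'le fun e => (hα' e).1, fun β hβ0 hβα' hβ => ?_⟩
  have hβS : ∀ e, β e = γ' e → α e = γ e := fun e he =>
    hagree e (le_antisymm (hα'le e) (he ▸ hβα' e))
  have hβα : (fun e => if β e = γ' e then γ e else 0) = α := by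
    refine hmin _ (fun e => ?_) (fun e => ?_) (hβ.transfer hγ' hγ (fun e => ?_) (fun e => ?_) ?_)
    · split_ifs; exacts [hγ.1 e, le_rfl]
    · dsimp only; split_ifs with h; exacts [(hβS e h).ge, hforce.1 e]
    · split_ifs; exacts [hγ.1 e, le_rfl]
    · dsimp only; split_ifs; exacts [le_rfl, hγ.1 e]
    · intro e he; exact if_pos he
  funext e
  by_cases h : β e = γ' e
  · rw [h, (hα' e).1 (hβS e h)]
  · have hαe : α e = 0 := by rw [← hβα]; exact if_neg h
    refine le_antisymm (hβα' e) ?_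
    by_cases hS : α e = γ e
    · exact ((hα' e).1 hS).trans_le (((hzero e).1 (hS ▸ hαe)).trans_le (hβ0 e))
    · exact ((hα' e).2 hS).trans_le (hβ0 e)
end

section
/- Let G be a finite simple bipartite graph, γ a fractional perfect matching of G, S ⊆ E(G), and T = E(G) \ supp(γ). Then there exists a fractional matching α with α ↑ γ and supp(α) = S if and only if the following two conditions hold: (1) S ⊆ supp(γ); (2) for every cycle C of G and every proper 2-coloring of the edges of C (i.e., the partition of the edges of C into its two alternating classes), each color class intersects T ∪ S. -/
open Finset

variable {V : Type} [Fintype V] [DecidableEq V]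

/-- `γ` is a fractional perfect matching of `G`. -/
def IsFPM (G : SimpleGraph V) [DecidableRel G.Adj] (γ : Sym2 V → ℝ) : Prop :=
  (∀ e, 0 ≤ γ e) ∧ (∀ e ∉ G.edgeSet, γ e = 0) ∧ ∀ v, vertexSum G γ v = 1

/-- `α ↑ γ` : `α` is a (nonnegative) forcing function for the fractional perfect matching
`γ`, i.e. `α ⪯ γ` and `γ` is the unique fractional perfect matching `γ'` with `α ⪯ γ'`. -/
def IsForcing (G : SimpleGraph V) [DecidableRel G.Adj] (α γ : Sym2 V → ℝ) : Prop :=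
  (∀ e, 0 ≤ α e) ∧ (∀ e ∉ G.edgeSet, α e = 0) ∧ α ≤ γ ∧
    ∀ γ', IsFPM G γ' → α ≤ γ' → γ' = γ

/-- `|α|`, the sum of the values of `α` over all edges of `G`. -/
def eSum (G : SimpleGraph V) [DecidableRel G.Adj] (α : Sym2 V → ℝ) : ℝ :=
  ∑ e ∈ G.edgeFinset, α e

/-- The fractional forcing number `f_f(G,γ) = min {|α| : α ↑ γ}`. -/
noncomputable def ffN (G : SimpleGraph V) [DecidableRel G.Adj] (γ : Sym2 V → ℝ) : ℝ :=
  sInf {x : ℝ | ∃ α, IsForcing G α γ ∧ x = eSum G α}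

/-- `α` is a fractional matching of `G`. -/
def IsFM (G : SimpleGraph V) [DecidableRel G.Adj] (α : Sym2 V → ℝ) : Prop :=
  (∀ e, 0 ≤ α e) ∧ (∀ e ∉ G.edgeSet, α e = 0) ∧ ∀ v, vertexSum G α v ≤ 1

namespace SimpleGraph

theorem exists_walk_of_sequence {V : Type} {G : SimpleGraph V} (g : ℕ → V)
    (hg : ∀ i, G.Adj (g i) (g (i + 1))) (n : ℕ) :
    ∃ p : G.Walk (g 0) (g n), p.support = (List.range (n + 1)).map g ∧
      p.edges = (List.range n).map fun i => s(g i, g (i + 1)) := by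
  induction n with
  | zero => exact ⟨.nil, by simp⟩
  | succ n ih =>
    obtain ⟨p, hs, he⟩ := ih
    refine ⟨p.concat (hg n), ?_, ?_⟩
    · rw [Walk.support_concat, hs, List.range_succ (n := n + 1)]
      simp
    · rw [Walk.edges_concat, he, List.range_succ (n := n)]
      simp

theorem exists_isCycle_of_iterate {V : Type} {G : SimpleGraph V} {f : V → V} {y : V}
    (hadj : ∀ i, G.Adj (f^[i] y) (f^[i + 1] y)) (hne : f (f y) ≠ y)
    (hy : y ∈ Function.periodicPts f) :
    ∃ c : G.Walk y y, c.IsCycle ∧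
      c.edges = (List.range (Function.minimalPeriod f y)).map
        fun i => s(f^[i] y, f^[i + 1] y) := by
  have hn : f^[Function.minimalPeriod f y] y = y := Function.iterate_minimalPeriod
  obtain ⟨p, hs, he⟩ : ∃ p : G.Walk y y,
      p.support = (List.range (Function.minimalPeriod f y + 1)).map (f^[·] y) ∧
      p.edges = (List.range (Function.minimalPeriod f y)).map
        fun i => s(f^[i] y, f^[i + 1] y) := by
    obtain ⟨p, hs, he⟩ := exists_walk_of_sequence (f^[·] y) hadj (Function.minimalPeriod f y)
    exact ⟨p.copy (Function.iterate_zero_apply f y) hn,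
      (p.support_copy _ _).trans hs, (p.edges_copy _ _).trans he⟩
  have hpos := Function.minimalPeriod_pos_of_mem_periodicPts hy
  have hlen : 3 ≤ p.length := by
    have hl : p.length = Function.minimalPeriod f y := by
      rw [← Walk.length_edges, he]; simp
    rw [hl]
    by_contra! hlt
    interval_cases h : Function.minimalPeriod f y
    · have := hadj 0
      simp only [zero_add, hn] at this
      exact this.ne rfl
    · exact hne hn
  refine ⟨p, ?_, he⟩
  have hnil : ¬ p.Nil := by
    rw [Walk.not_nil_iff_lt_length]
    lia
  rw [Walk.isCycle_iff_isPath_tail_and_le_length, Walk.isPath_def,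
    Walk.support_tail_of_not_nil _ hnil, hs]
  refine ⟨?_, hlen⟩
  rw [List.range_succ_eq_map, List.map_cons, List.tail_cons, List.map_map]
  refine List.Nodup.map_on (fun i hi j hj hij => ?_) List.nodup_range
  rw [List.mem_range, ← Function.minimalPeriod_apply hy] at hi hj
  exact Function.iterate_injOn_Iio_minimalPeriod hi hj (by simpa using hij)

end SimpleGraph

theorem exists_alternating_cycle_of_vertexSum_eq_zero {G : SimpleGraph V} [DecidableRel G.Adj]
    (C : G.Coloring (Fin 2)) {D : Sym2 V → ℝ} (hD : ∀ e ∉ G.edgeSet, D e = 0)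
    (hsum : ∀ v, vertexSum G D v = 0) (hne : D ≠ 0) :
    ∃ (y : V) (c : G.Walk y y) (κ : ℕ → Bool), c.IsCycle ∧
      (∀ i, κ i ≠ κ ((i + 1) % c.edges.length)) ∧
      ∀ i : Fin c.edges.length, κ i = false → D (c.edges.get i) < 0 := by
  have hadj {v w : V} (h : D s(v, w) ≠ 0) : G.Adj v w := by
    by_contra h'
    exact h (hD _ h')
  let σ : V → ℝ := fun v => if C v = 0 then 1 else -1
  have hσ {v w : V} (h : G.Adj v w) : σ w = - σ v := by
    have := C.valid h
    by_cases h0 : C v = 0 <;> by_cases h1 : C w = 0 <;> simp [σ, h0, h1] <;> lia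
  have hσ0 (v : V) : σ v ≠ 0 := by
    simp only [σ]; split_ifs <;> norm_num
  have hstep (v : V) : ∃ w, (∃ u, D s(v, u) ≠ 0) → 0 < σ v * D s(v, w) := by
    by_cases hv : ∃ u, D s(v, u) ≠ 0
    · obtain ⟨u, hu⟩ := hv
      have h0 : ∑ e ∈ G.edgeFinset, σ v * (if v ∈ e then D e else 0) = 0 := by
        rw [← Finset.mul_sum]
        exact mul_eq_zero_of_right _ (hsum v)
      obtain ⟨e, -, he⟩ := Finset.exists_pos_of_sum_zero_of_exists_nonzero _ h0
        ⟨s(v, u), by simpa using hadj hu, by simp [hσ0 v, hu]⟩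
      split_ifs at he with hve
      · obtain ⟨w, rfl⟩ := hve
        exact ⟨w, fun _ => he⟩
      · simp at he
    · exact ⟨v, fun h => absurd h hv⟩
  choose f hf using hstep
  obtain ⟨x, hx⟩ : ∃ x, ∃ u, D s(x, u) ≠ 0 := by
    by_contra! h
    exact hne (funext fun e => e.ind h)
  have hactive (v : V) (hv : ∃ u, D s(v, u) ≠ 0) : ∃ u, D s(f v, u) ≠ 0 :=
    ⟨v, by rw [Sym2.eq_swap]; exact right_ne_zero_of_mul (hf v hv).ne'⟩
  have hiter (v : V) (hv : ∃ u, D s(v, u) ≠ 0) (i : ℕ) : ∃ u, D s(f^[i] v, u) ≠ 0 := by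
    induction i with
    | zero => exact hv
    | succ i ih => rw [Function.iterate_succ_apply']; exact hactive _ ih
  obtain ⟨i, j, hij, heq⟩ := Finite.exists_ne_map_eq_of_infinite fun i : ℕ => f^[i] x
  wlog hlt : i < j generalizing i j
  · exact this j i hij.symm heq.symm (by lia)
  set y := f^[i] x with hydef
  have hy : ∃ u, D s(y, u) ≠ 0 := hiter x hx i
  have hper : y ∈ Function.periodicPts f := by
    refine Function.mk_mem_periodicPts (n := j - i) (by lia) ?_
    change f^[j - i] y = y
    rw [hydef, ← Function.iterate_add_apply, Nat.sub_add_cancel hlt.le]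
    exact heq.symm
  have hpos (i : ℕ) : 0 < σ (f^[i] y) * D s(f^[i] y, f^[i + 1] y) := by
    rw [Function.iterate_succ_apply']
    exact hf _ (hiter y hy i)
  have hadj' (i : ℕ) : G.Adj (f^[i] y) (f^[i + 1] y) :=
    hadj (right_ne_zero_of_mul (hpos i).ne')
  have hff : f (f y) ≠ y := by
    intro h
    have h0 := hpos 0
    have h1 := hpos 1
    have h2 := hσ (hadj' 0)
    simp only [zero_add, Function.iterate_succ_apply, Function.iterate_zero_apply, h] at h0 h1 h2
    rw [Sym2.eq_swap, h2] at h1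
    linarith
  obtain ⟨c, hc, he⟩ := SimpleGraph.exists_isCycle_of_iterate hadj' hff hper
  refine ⟨y, c, fun i => decide (C (f^[i] y) = 0), hc, fun i => ?_, fun i hi => ?_⟩
  · rw [he, List.length_map, List.length_range]
    beta_reduce
    rw [Function.iterate_mod_minimalPeriod_eq]
    have := C.valid (hadj' i)
    simp only [ne_eq, decide_eq_decide]
    lia
  · have hi' : σ (f^[i] y) = -1 := if_neg (of_decide_eq_false hi)
    have := hpos i
    rw [hi'] at this
    have hget : c.edges.get i = s(f^[i] y, f^[i + 1] y) := by
      simp [he]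
    rw [hget]
    linarith

theorem sum_alternating_closed_sequence {V : Type} [DecidableEq V] {n : ℕ} (g : ℕ → V)
    (hg : g n = g 0) (s : ℕ → ℝ) (hs : ∀ i, s (i + 1) = - s i) (hsn : s n = s 0)
    (hne : ∀ i < n, g i ≠ g (i + 1)) (v : V) :
    ∑ i ∈ range n, (if v ∈ s(g i, g (i + 1)) then s i else 0) = 0 := by
  let F : ℕ → ℝ := fun i => if v = g i then s i else 0
  have hF : ∀ i ∈ range n, (if v ∈ s(g i, g (i + 1)) then s i else 0) = F i - F (i + 1) := by
    intro i hi
    have := hne i (mem_range.1 hi)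
    simp only [F, hs, Sym2.mem_iff]
    split_ifs <;> grind
  rw [sum_congr rfl hF, sum_range_sub']
  simp [F, hg, hsn]

theorem exists_pos_le_of_ne_zero {ι : Type*} [Finite ι] {γ : ι → ℝ} (hγ : ∀ e, 0 ≤ γ e) :
    ∃ ε > 0, ∀ e, γ e ≠ 0 → ε ≤ γ e := by
  classical
  cases nonempty_fintype ι
  by_cases h : (univ.filter fun e => γ e ≠ 0).Nonempty
  · obtain ⟨e, he, hmin⟩ := exists_min_image _ γ h
    rw [mem_filter_univ] at he
    exact ⟨γ e, (hγ e).lt_of_ne' he, fun e' he' => hmin e' (by simpa using he')⟩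
  · refine ⟨1, one_pos, fun e he => ?_⟩
    exact absurd ⟨e, by simpa using he⟩ h

theorem exists_alternating_perturbation {G : SimpleGraph V} [DecidableRel G.Adj] {v : V}
    {c : G.Walk v v} (hc : c.IsCycle) (κ : Fin c.edges.length → Bool)
    (hκ : ∀ i : Fin c.edges.length, κ i ≠ κ ⟨(i.1 + 1) % c.edges.length,
      Nat.mod_lt _ (lt_of_le_of_lt (Nat.zero_le _) i.isLt)⟩) (b : Bool) :
    ∃ D : Sym2 V → ℝ, (∀ e ∉ c.edges, D e = 0) ∧
      (∀ i, D (c.edges.get i) = if κ i = b then -1 else 1) ∧ ∀ u, vertexSum G D u = 0 := by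
  let D : Sym2 V → ℝ := fun e =>
    ∑ i, if c.edges.get i = e then (if κ i = b then -1 else 1) else 0
  have hinj := List.nodup_iff_injective_get.1 hc.edges_nodup
  refine ⟨D, fun e he => ?_, fun i => ?_, fun u => ?_⟩
  · refine sum_eq_zero fun i _ => if_neg ?_
    rintro rfl
    exact he (List.get_mem _ _)
  · simp only [D, hinj.eq_iff]
    simp
  · have hlen : 0 < c.edges.length := by
      rw [SimpleGraph.Walk.length_edges]
      have := hc.three_le_length
      lia
    let k : ℕ → ℝ := fun i => if κ ⟨i % c.edges.length, Nat.mod_lt _ hlen⟩ = b then -1 else 1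
    have hk (i : ℕ) : k (i + 1) = - k i := by
      have := hκ ⟨i % c.edges.length, Nat.mod_lt _ hlen⟩
      simp only [Nat.mod_add_mod] at this
      simp only [k]
      generalize κ ⟨i % c.edges.length, _⟩ = p at this ⊢
      generalize κ ⟨(i + 1) % c.edges.length, _⟩ = q at this ⊢
      cases p <;> cases q <;> cases b <;> simp_all
    have hget (i : Fin c.edges.length) : c.edges.get i = s(c.getVert i, c.getVert (i + 1)) := by
      rw [List.get_eq_getElem, SimpleGraph.Walk.getElem_edges]
    have hsum := sum_alternating_closed_sequence (n := c.edges.length) c.getVert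
      (by simp) k hk
      (by simp only [k]; congr! 4; simp)
      (fun i hi => (c.adj_getVert_succ (by simpa using hi)).ne) u
    rw [← Fin.sum_univ_eq_sum_range
      (fun i => if u ∈ s(c.getVert i, c.getVert (i + 1)) then k i else 0)] at hsum
    rw [← hsum]
    simp only [vertexSum, D]
    have (e : Sym2 V) : (if u ∈ e then ∑ i, if c.edges.get i = e then
          (if κ i = b then (-1 : ℝ) else 1) else 0 else 0) =
        ∑ i, if c.edges.get i = e then (if u ∈ c.edges.get i then
          (if κ i = b then (-1 : ℝ) else 1) else 0) else 0 := by
      split_ifs with h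
      · exact sum_congr rfl fun i _ => by split_ifs <;> simp_all
      · exact (sum_eq_zero fun i _ => by split_ifs <;> simp_all).symm
    simp only [this]
    rw [sum_comm]
    refine sum_congr rfl fun i _ => ?_
    have hmem : c.edges.get i ∈ G.edgeFinset :=
      SimpleGraph.mem_edgeFinset.2 (c.edges_subset_edgeSet (List.get_mem _ _))
    rw [sum_ite_eq, if_pos hmem, hget]
    simp only [k, Nat.mod_eq_of_lt i.isLt]

theorem vertexSum_add_smul (G : SimpleGraph V) [DecidableRel G.Adj] (γ D : Sym2 V → ℝ) (ε : ℝ)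
    (v : V) : vertexSum G (γ + ε • D) v = vertexSum G γ v + ε * vertexSum G D v := by
  simp only [vertexSum, mul_sum, ← sum_add_distrib]
  refine sum_congr rfl fun e _ => ?_
  split_ifs <;> simp

theorem vertexSum_mono {G : SimpleGraph V} [DecidableRel G.Adj] {α γ : Sym2 V → ℝ} (h : α ≤ γ)
    (v : V) : vertexSum G α v ≤ vertexSum G γ v :=
  sum_le_sum fun e _ => by split_ifs <;> simp [h e]

/-- For a bipartite graph `G`, a fractional perfect matching `γ` and `S ⊆ E(G)`, with
`T = E(G) \ supp(γ)`: there is a fractional matching `α` with `α ↑ γ` and `supp(α) = S`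
iff `S ⊆ supp(γ)` and, for every cycle `C` of `G` and every proper 2-coloring of the
edges of `C` (adjacent edges of the cycle get different colors), each color class meets
`T ∪ S`. -/
theorem forcing_function_with_support_iff (G : SimpleGraph V) [DecidableRel G.Adj]
    (hbip : G.Colorable 2) (γ : Sym2 V → ℝ) (hγ : IsFPM G γ)
    (S : Set (Sym2 V)) (hS : S ⊆ G.edgeSet) :
    (∃ α, IsFM G α ∧ IsForcing G α γ ∧ {e | α e ≠ 0} = S) ↔
      (S ⊆ {e | γ e ≠ 0} ∧
        ∀ (v : V) (c : G.Walk v v), c.IsCycle →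
          ∀ κ : Fin c.edges.length → Bool,
            (∀ i : Fin c.edges.length,
              κ i ≠ κ ⟨(i.1 + 1) % c.edges.length,
                        Nat.mod_lt _ (lt_of_le_of_lt (Nat.zero_le _) i.isLt)⟩) →
            ∀ b : Bool, ∃ i : Fin c.edges.length,
              κ i = b ∧ c.edges.get i ∈ (G.edgeSet \ {e | γ e ≠ 0}) ∪ S) := by
  constructor
  · rintro ⟨α, -, ⟨hα0, hαG, hle, huniq⟩, rfl⟩
    refine ⟨fun e he h0 => he (le_antisymm ((hle e).trans h0.le) (hα0 e)), ?_⟩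
    intro v c hc κ hκ b
    by_contra! hcon
    obtain ⟨D, hDoff, hDon, hDsum⟩ := exists_alternating_perturbation hc κ hκ b
    obtain ⟨ε, hε, hεle⟩ := exists_pos_le_of_ne_zero hγ.1
    have hαle : α ≤ γ + ε • D := by
      intro e
      simp only [Pi.add_apply, Pi.smul_apply, smul_eq_mul]
      by_cases he : e ∈ c.edges
      · obtain ⟨i, rfl⟩ := List.mem_iff_get.1 he
        have hmem := c.edges_subset_edgeSet he
        rw [hDon]
        split_ifs with hi
        · have h := hcon i hi
          simp only [Set.mem_union, Set.mem_sdiff, hmem, true_and, not_or, Set.mem_ofPred_eq,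
            not_not] at h
          rw [h.2]
          linarith [hεle _ h.1]
        · linarith [hle (c.edges.get i)]
      · rw [hDoff e he, mul_zero, add_zero]
        exact hle e
    have heq := huniq (γ + ε • D) ⟨fun e => (hα0 e).trans (hαle e), fun e he => ?_, fun u => ?_⟩
      hαle
    · have hlen : 0 < c.edges.length := by
        rw [SimpleGraph.Walk.length_edges]
        have := hc.three_le_length
        lia
      have h := congrFun heq (c.edges.get ⟨0, hlen⟩)
      simp only [Pi.add_apply, Pi.smul_apply, smul_eq_mul, hDon, add_eq_left, mul_eq_zero,
        hε.ne', false_or] at h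
      split_ifs at h <;> norm_num at h
    · have : e ∉ c.edges := fun h => he (c.edges_subset_edgeSet h)
      simp [hγ.2.1 e he, hDoff e this]
    · rw [vertexSum_add_smul, hDsum, hγ.2.2, mul_zero, add_zero]
  · rintro ⟨hSγ, hcyc⟩
    have hle : S.indicator γ ≤ γ := Set.indicator_le_self' fun e _ => hγ.1 e
    have h0 (e : Sym2 V) : 0 ≤ S.indicator γ e := Set.indicator_nonneg (fun e _ => hγ.1 e) e
    have hoff (e : Sym2 V) (he : e ∉ G.edgeSet) : S.indicator γ e = 0 :=
      Set.indicator_of_notMem (fun h => he (hS h)) _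
    refine ⟨S.indicator γ, ⟨h0, hoff, fun v => (vertexSum_mono hle v).trans (hγ.2.2 v).le⟩,
      ⟨h0, hoff, hle, fun γ' hγ' hle' => ?_⟩, ?_⟩
    · by_contra hne
      obtain ⟨y, c, κ, hc, hκ, hneg⟩ := exists_alternating_cycle_of_vertexSum_eq_zero hbip.some
        (D := γ' + (-1 : ℝ) • γ) (fun e he => by simp [hγ.2.1 e he, hγ'.2.1 e he])
        (fun v => by rw [vertexSum_add_smul, hγ.2.2, hγ'.2.2]; norm_num)
        (fun h => hne (by simpa [add_neg_eq_zero] using h))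
      obtain ⟨i, hi, hmem⟩ := hcyc y c hc (fun i => κ i) (fun i => hκ i) false
      have hlt := hneg i hi
      simp only [Pi.add_apply, Pi.smul_apply, smul_eq_mul] at hlt
      rcases hmem with ⟨-, hT⟩ | hmemS
      · have hz : γ (c.edges.get i) = 0 := by simpa using hT
        linarith [hγ'.1 (c.edges.get i)]
      · have := hle' (c.edges.get i)
        rw [Set.indicator_of_mem hmemS] at this
        linarith
    · ext e
      simp only [ne_eq, Set.mem_ofPred_eq, Set.indicator_apply_eq_zero, not_forall, exists_prop]
      exact ⟨fun h => h.1, fun h => ⟨h, hSγ h⟩⟩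
end

section
/- Let G be a finite simple graph and γ, γ₁, …, γ_n fractional perfect matchings of G such that γ = Σᵢ λᵢ γᵢ is a convex combination (λᵢ ≥ 0, Σᵢ λᵢ = 1). Let α be a minimal forcing function for γ (α ⇑ γ). Then there exist functions α₁, …, α_n : E(G) → ℝ≥0 such that α = Σᵢ λᵢ αᵢ and, for every i, αᵢ is a forcing function for γᵢ (αᵢ ↑ γᵢ). -/
open Finset

variable {V : Type} [Fintype V] [DecidableEq V]

/-- `α ⇑ γ` : `α` is a minimal forcing function for `γ`. -/
def IsMinForcing (G : SimpleGraph V) [DecidableRel G.Adj] (α γ : Sym2 V → ℝ) : Prop :=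
  IsForcing G α γ ∧ ∀ α', (∀ e, 0 ≤ α' e) → α' ≤ α → IsForcing G α' γ → α' = α

/-- A forcing function for `γ` rules out every nonzero direction `d` in the kernel of the vertex
sums that is nonnegative where `α` and `γ` agree. -/
theorem IsForcing.direction_eq_zero {G : SimpleGraph V} [DecidableRel G.Adj]
    {α γ d : Sym2 V → ℝ} (h : IsForcing G α γ) (hγ : IsFPM G γ)
    (hd : ∀ e ∉ G.edgeSet, d e = 0) (hsum : ∀ v, vertexSum G d v = 0)
    (hpos : ∀ e, α e = γ e → 0 ≤ d e) : d = 0 := by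
  obtain ⟨hα0, -, hαγ, huniq⟩ := h
  have hev : ∀ᶠ ε : ℝ in nhdsWithin 0 (Set.Ioi 0), ∀ e, α e ≤ γ e + ε * d e := by
    rw [Filter.eventually_all]
    intro e
    rcases (hαγ e).eq_or_lt with he | he
    · filter_upwards [self_mem_nhdsWithin] with ε hε
      have := mul_nonneg (le_of_lt hε) (hpos e he)
      linarith
    · have hc : Continuous fun ε : ℝ => γ e + ε * d e := by fun_prop
      have ht : ∀ᶠ ε : ℝ in nhds 0, α e < γ e + ε * d e :=
        hc.continuousAt.eventually (lt_mem_nhds (by simpa using he))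
      exact (ht.filter_mono nhdsWithin_le_nhds).mono fun _ => le_of_lt
  obtain ⟨ε, hε, hε0⟩ := (hev.and self_mem_nhdsWithin).exists
  have hε0 : 0 < ε := hε0
  have hfpm : IsFPM G fun e => γ e + ε * d e := by
    refine ⟨fun e => (hα0 e).trans (hε e), fun e he => by simp [hγ.2.1 e he, hd e he], fun v => ?_⟩
    have : vertexSum G (fun e => γ e + ε * d e) v = vertexSum G γ v + ε * vertexSum G d v := by
      simp only [vertexSum, Finset.mul_sum, ← Finset.sum_add_distrib]
      exact Finset.sum_congr rfl fun e _ => by split_ifs <;> simp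
    rw [this, hγ.2.2 v, hsum v, mul_zero, add_zero]
  funext e
  have := congrFun (huniq _ hfpm hε) e
  simpa [hε0.ne'] using this

/-- If `α ↑ γ`, then restricting any fractional perfect matching `δ` to the edges on which `α` and
`γ` agree gives a forcing function for `δ`. -/
theorem IsForcing.restrict {G : SimpleGraph V} [DecidableRel G.Adj]
    {α γ δ : Sym2 V → ℝ} (h : IsForcing G α γ) (hγ : IsFPM G γ) (hδ : IsFPM G δ) :
    IsForcing G (fun e => if α e = γ e then δ e else 0) δ := by
  refine ⟨fun e => ?_, fun e he => by simp [hδ.2.1 e he], fun e => ?_, fun δ' hδ' hle => ?_⟩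
  · dsimp only
    split_ifs
    exacts [hδ.1 e, le_rfl]
  · dsimp only
    split_ifs
    exacts [le_rfl, hδ.1 e]
  · refine sub_eq_zero.mp (h.direction_eq_zero hγ (fun e he => ?_) (fun v => ?_) fun e he => ?_)
    · simp [hδ.2.1 e he, hδ'.2.1 e he]
    · have : vertexSum G (δ' - δ) v = vertexSum G δ' v - vertexSum G δ v := by
        simp only [vertexSum, ← Finset.sum_sub_distrib]
        exact Finset.sum_congr rfl fun e _ => by split_ifs <;> simp
      rw [this, hδ.2.2 v, hδ'.2.2 v, sub_self]
    · have := hle e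
      simp only [he, if_true] at this
      simpa using this

/-- A convex combination of fractional perfect matchings is a fractional perfect matching. -/
theorem IsFPM.convex_sum {G : SimpleGraph V} [DecidableRel G.Adj] {ι : Type*} [Fintype ι]
    {l : ι → ℝ} (hl : ∀ i, 0 ≤ l i) (hl1 : ∑ i, l i = 1)
    {γ : ι → Sym2 V → ℝ} (hγ : ∀ i, IsFPM G (γ i)) :
    IsFPM G fun e => ∑ i, l i * γ i e := by
  refine ⟨fun e => Finset.sum_nonneg fun i _ => mul_nonneg (hl i) ((hγ i).1 e),
    fun e he => Finset.sum_eq_zero fun i _ => by simp [(hγ i).2.1 e he], fun v => ?_⟩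
  have : vertexSum G (fun e => ∑ i, l i * γ i e) v = ∑ i, l i * vertexSum G (γ i) v := by
    simp only [vertexSum, Finset.mul_sum]
    rw [Finset.sum_comm]
    exact Finset.sum_congr rfl fun e _ => by split_ifs <;> simp
  simp [this, (hγ _).2.2 v, hl1]

/-- If `γ = Σ λᵢ γᵢ` is a convex combination of fractional perfect matchings and `α ⇑ γ`,
then `α = Σ λᵢ αᵢ` for some nonnegative `αᵢ` with `αᵢ ↑ γᵢ` for every `i`. -/
theorem minForcing_decomposes (G : SimpleGraph V) [DecidableRel G.Adj]
    (n : ℕ) (l : Fin n → ℝ) (hl : ∀ i, 0 ≤ l i) (hl1 : ∑ i, l i = 1)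
    (γi : Fin n → Sym2 V → ℝ) (hγi : ∀ i, IsFPM G (γi i))
    (γ : Sym2 V → ℝ) (hγ : γ = fun e => ∑ i, l i * γi i e)
    (α : Sym2 V → ℝ) (hα : IsMinForcing G α γ) :
    ∃ αi : Fin n → Sym2 V → ℝ,
      (∀ i e, 0 ≤ αi i e) ∧ (∀ e, α e = ∑ i, l i * αi i e) ∧
        ∀ i, IsForcing G (αi i) (γi i) := by
  have hfpm : IsFPM G γ := hγ ▸ IsFPM.convex_sum hl hl1 hγi
  have hres {δ : Sym2 V → ℝ} (hδ : IsFPM G δ) := hα.1.restrict hfpm hδ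
  have heq : (fun e => if α e = γ e then γ e else 0) = α := by
    refine hα.2 _ (hres hfpm).1 (fun e => ?_) (hres hfpm)
    dsimp only
    split_ifs with he
    exacts [he.ge, hα.1.1 e]
  refine ⟨fun i e => if α e = γ e then γi i e else 0, fun i => (hres (hγi i)).1, fun e => ?_,
    fun i => hres (hγi i)⟩
  by_cases he : α e = γ e
  · simp [he, hγ]
  · have h0 : α e = 0 := by simpa only [he, if_false] using (congrFun heq e).symm
    simpa only [he, if_false, mul_zero, Finset.sum_const_zero] using h0
end

section
/- Let G be a finite simple graph, M a perfect matching of G, and 𝟙_M : E(G) → ℝ its characteristic function (which is a fractional perfect matching of G). If α is a forcing function for 𝟙_M (α ↑ 𝟙_M), then supp(α) is a forcing set for M. -/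
open Finset

variable {V : Type} [Fintype V] [DecidableEq V]

/-- `M` is a perfect matching of `G`: a set of pairwise disjoint edges covering every
vertex, i.e. every vertex lies in exactly one edge of `M`. -/
def IsPM (G : SimpleGraph V) (M : Finset (Sym2 V)) : Prop :=
  ↑M ⊆ G.edgeSet ∧ ∀ v : V, ∃! e, e ∈ M ∧ v ∈ e

/-- The characteristic function `𝟙_M` of a set of edges `M`. -/
def charF (M : Finset (Sym2 V)) : Sym2 V → ℝ := fun e => if e ∈ M then 1 else 0

/-- `S` is a forcing set for the perfect matching `M`: `S ⊆ M` and `M` is the unique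
perfect matching of `G` containing `S`. -/
def IsForcingSet (G : SimpleGraph V) (S : Set (Sym2 V)) (M : Finset (Sym2 V)) : Prop :=
  S ⊆ ↑M ∧ ∀ M', IsPM G M' → S ⊆ ↑M' → M' = M

/-- The forcing number `f(G,M)`: the minimum size of a forcing set for `M`. -/
noncomputable def fN (G : SimpleGraph V) (M : Finset (Sym2 V)) : ℕ :=
  sInf {n : ℕ | ∃ S : Finset (Sym2 V), IsForcingSet G ↑S M ∧ S.card = n}

theorem charF_nonneg {W : Type} [DecidableEq W] (M : Finset (Sym2 W)) (e : Sym2 W) : 0 ≤ charF M e := by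
  unfold charF
  split_ifs <;> norm_num

theorem charF_le_one {W : Type} [DecidableEq W] (M : Finset (Sym2 W)) (e : Sym2 W) : charF M e ≤ 1 := by
  unfold charF
  split_ifs <;> norm_num

theorem charF_injective {W : Type} [DecidableEq W] :
    Function.Injective (charF (V := W)) := by
  intro M N h
  ext e
  have he := congrFun h e
  by_cases hM : e ∈ M <;> by_cases hN : e ∈ N <;> simp_all [charF]

/-- The characteristic function of a perfect matching is a fractional perfect matching. -/
theorem IsPM.isFPM_charF {G : SimpleGraph V} [DecidableRel G.Adj] {M : Finset (Sym2 V)}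
    (hM : IsPM G M) : IsFPM G (charF M) := by
  refine ⟨charF_nonneg M, fun e he => if_neg fun h => he (hM.1 h), fun v => ?_⟩
  obtain ⟨e, ⟨heM, hve⟩, huniq⟩ := hM.2 v
  unfold vertexSum
  rw [Finset.sum_eq_single_of_mem e (SimpleGraph.mem_edgeFinset.2 (hM.1 heM))]
  · simp [charF, heM, hve]
  · intro f _ hfe
    by_cases hvf : v ∈ f
    · have hfM : f ∉ M := fun hfM => hfe (huniq f ⟨hfM, hvf⟩)
      simp [charF, hfM]
    · simp [hvf]

/-- If `α` is a forcing function for the characteristic function `𝟙_M` of a perfect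
matching `M`, then `supp(α)` is a forcing set for `M`. -/
theorem support_of_forcing_is_forcingSet (G : SimpleGraph V) [DecidableRel G.Adj]
    (M : Finset (Sym2 V)) (hM : IsPM G M)
    (α : Sym2 V → ℝ) (hα : IsForcing G α (charF M)) :
    IsForcingSet G {e | α e ≠ 0} M := by
  obtain ⟨hnonneg, -, hle, huniq⟩ := hα
  refine ⟨fun e he => ?_, fun M' hM' hsub =>
    charF_injective (huniq _ hM'.isFPM_charF fun e => ?_)⟩
  · by_contra h
    have h' : e ∉ M := h
    have := hle e
    simp only [charF, if_neg h'] at this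
    exact he (le_antisymm this (hnonneg e))
  · by_cases he : α e = 0
    · exact he ▸ charF_nonneg M' e
    · have heM' : e ∈ M' := hsub he
      calc α e ≤ charF M e := hle e
        _ ≤ 1 := charF_le_one M e
        _ = charF M' e := (if_pos heM').symm
end

section
/- For every nonnegative integer s there exists a finite simple graph G with at least one perfect matching such that f(G) − f_f(G) = s, and there exists a finite simple graph G' with at least one perfect matching such that f(G') − f_f(G') = s + 1/2. -/
open Finset

variable {V : Type} [Fintype V] [DecidableEq V]

/-- `f_f(G)`, the minimum of `f_f(G,γ)` over all fractional perfect matchings `γ`. -/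
noncomputable def ffMin (G : SimpleGraph V) [DecidableRel G.Adj] : ℝ :=
  sInf {x : ℝ | ∃ γ, IsFPM G γ ∧ ffN G γ = x}

/-- `F_f(G)`, the maximum of `f_f(G,γ)` over all fractional perfect matchings `γ`. -/
noncomputable def ffMax (G : SimpleGraph V) [DecidableRel G.Adj] : ℝ :=
  sSup {x : ℝ | ∃ γ, IsFPM G γ ∧ ffN G γ = x}

/-- `f(G)`, the minimum of `f(G,M)` over all perfect matchings `M` of `G`. -/
noncomputable def fMin (G : SimpleGraph V) : ℕ :=
  sInf {n : ℕ | ∃ M, IsPM G M ∧ fN G M = n}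

theorem subset_iff_charF {U : Type} [DecidableEq U] {M S : Finset (Sym2 U)} :
    (S : Set (Sym2 U)) ⊆ ↑M ↔ ∀ e ∈ S, charF M e = 1 := by
  simp [charF, Set.subset_def]

theorem charF_injective_s8 {U : Type} [DecidableEq U] :
    Function.Injective (charF : Finset (Sym2 U) → Sym2 U → ℝ) := by
  intro M N h
  ext e
  have := congrFun h e
  unfold charF at this
  by_cases h₁ : e ∈ M <;> by_cases h₂ : e ∈ N <;> simp_all

theorem IsPM.isForcingSet_self {U : Type} {G : SimpleGraph U} {M : Finset (Sym2 U)}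
    (hM : IsPM G M) : IsForcingSet G ↑M M := by
  refine ⟨subset_rfl, fun M' hM' h => ?_⟩
  refine Finset.Subset.antisymm (fun e he => ?_) (Finset.coe_subset.1 h)
  induction e using Sym2.ind with
  | _ a b =>
    obtain ⟨e', ⟨he', hae'⟩, -⟩ := hM.2 a
    rwa [(hM'.2 a).unique ⟨he, Sym2.mem_mk_left a b⟩ ⟨h he', hae'⟩]

theorem fMin_eq_of_forall {U : Type} {G : SimpleGraph U} {n : ℕ}
    {M S : Finset (Sym2 U)}
    (hM : IsPM G M) (hS : IsForcingSet G ↑S M) (hn : S.card ≤ n)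
    (h : ∀ (M S : Finset (Sym2 U)), IsPM G M → IsForcingSet G ↑S M → n ≤ S.card) :
    fMin G = n := by
  apply le_antisymm
  · exact (show fMin G ≤ fN G M from Nat.sInf_le ⟨M, hM, rfl⟩).trans
      ((show fN G M ≤ S.card from Nat.sInf_le ⟨S, hS, rfl⟩).trans hn)
  · refine le_csInf ⟨_, M, hM, rfl⟩ ?_
    rintro _ ⟨N, hN, rfl⟩
    refine le_csInf ⟨_, N, hN.isForcingSet_self, rfl⟩ ?_
    rintro _ ⟨T, hT, rfl⟩
    exact h N T hN hT

section General

variable (G : SimpleGraph V) [DecidableRel G.Adj]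

theorem vertexSum_eq_sum_adj (γ : Sym2 V → ℝ) (v : V) :
    vertexSum G γ v = ∑ w, if G.Adj v w then γ s(v, w) else 0 := by
  unfold vertexSum
  rw [← Finset.sum_filter, ← Finset.sum_filter]
  symm
  refine Finset.sum_bij (fun w _ => s(v, w)) ?_ ?_ ?_ ?_
  · intro w hw
    simpa using hw
  · intro a _ b _ h
    exact Sym2.congr_right.1 h
  · intro e he
    simp only [Finset.mem_filter, SimpleGraph.mem_edgeFinset] at he
    obtain ⟨w, rfl⟩ := he.2
    exact ⟨w, by simpa using he.1, rfl⟩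
  · intro _ _
    rfl

theorem sum_vertexSum (α : Sym2 V → ℝ) : ∑ v, vertexSum G α v = 2 * eSum G α := by
  unfold vertexSum eSum
  rw [Finset.sum_comm, Finset.mul_sum]
  refine Finset.sum_congr rfl fun e he => ?_
  rw [← Finset.sum_filter, Finset.sum_const]
  induction e using Sym2.ind with
  | _ a b =>
    have hab : a ≠ b := G.ne_of_adj (by simpa using he)
    have : (univ.filter fun v => v ∈ s(a, b)) = {a, b} := by
      ext v
      simp
    rw [this, Finset.card_pair hab]
    simp

variable {G}

theorem isPM_iff_isFPM_charF {M : Finset (Sym2 V)} : IsPM G M ↔ IsFPM G (charF M) := by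
  have hsum (h : ↑M ⊆ G.edgeSet) (v : V) :
      vertexSum G (charF M) v = ((M.filter fun e => v ∈ e).card : ℝ) := by
    unfold vertexSum charF
    rw [Finset.card_filter, Nat.cast_sum, ← Finset.sum_subset (s₁ := M)]
    · refine Finset.sum_congr rfl fun e he => ?_
      simp [he]
    · intro e he
      exact SimpleGraph.mem_edgeFinset.2 (h he)
    · intro e _ he
      simp [he]
  have hcard (v : V) : (M.filter fun e => v ∈ e).card = 1 ↔ ∃! e, e ∈ M ∧ v ∈ e := by
    rw [Finset.card_eq_one]
    simp only [Finset.ext_iff, Finset.mem_filter, Finset.mem_singleton, ExistsUnique]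
    exact ⟨fun ⟨a, ha⟩ => ⟨a, (ha a).2 rfl, fun y hy => (ha y).1 hy⟩,
      fun ⟨a, ha, h⟩ => ⟨a, fun y => ⟨h y, fun hy => hy ▸ ha⟩⟩⟩
  constructor
  · rintro ⟨h, hM⟩
    refine ⟨fun e => ?_, fun e he => ?_, fun v => ?_⟩
    · unfold charF
      split_ifs <;> norm_num
    · exact if_neg fun h' => he (h h')
    · rw [hsum h, (hcard v).2 (hM v), Nat.cast_one]
  · rintro ⟨-, h, hM⟩
    have hsub : ↑M ⊆ G.edgeSet := by
      intro e he
      by_contra hne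
      have := h e hne
      rw [charF, if_pos (Finset.mem_coe.1 he)] at this
      exact one_ne_zero this
    refine ⟨hsub, fun v => (hcard v).1 ?_⟩
    have := hM v
    rw [hsum hsub] at this
    exact_mod_cast this

theorem IsForcing.eSum_nonneg {α γ : Sym2 V → ℝ} (h : IsForcing G α γ) : 0 ≤ eSum G α :=
  Finset.sum_nonneg fun e _ => h.1 e

theorem ffMin_eq_of_forall {r : ℝ} {α γ : Sym2 V → ℝ} (hγ : IsFPM G γ)
    (hα : IsForcing G α γ) (hr : eSum G α ≤ r)
    (h : ∀ α γ, IsFPM G γ → IsForcing G α γ → r ≤ eSum G α) : ffMin G = r := by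
  have hle (γ) (hγ : IsFPM G γ) : r ≤ ffN G γ := by
    have hself : IsForcing G γ γ := by
      refine ⟨hγ.1, hγ.2.1, le_rfl, fun γ' hγ' hle => ?_⟩
      have hv (v : V) : vertexSum G γ v = vertexSum G γ' v := (hγ.2.2 v).trans (hγ'.2.2 v).symm
      ext e
      by_cases he : e ∈ G.edgeSet
      · induction e using Sym2.ind with
        | _ a b =>
          have := (Finset.sum_eq_sum_iff_of_le fun e _ => by
            split_ifs
            exacts [hle e, le_rfl]).1 (hv a) s(a, b) (SimpleGraph.mem_edgeFinset.2 he)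
          simpa using this.symm
      · rw [hγ.2.1 e he, hγ'.2.1 e he]
    refine le_csInf ⟨_, γ, hself, rfl⟩ ?_
    rintro _ ⟨α, hα, rfl⟩
    exact h α γ hγ hα
  apply le_antisymm
  · refine (show ffMin G ≤ ffN G γ from csInf_le ⟨r, ?_⟩ ⟨γ, hγ, rfl⟩).trans
      ((show ffN G γ ≤ eSum G α from csInf_le ⟨0, ?_⟩ ⟨α, hα, rfl⟩).trans hr)
    · rintro _ ⟨γ, hγ, rfl⟩
      exact hle γ hγ
    · rintro _ ⟨α, hα, rfl⟩
      exact hα.eSum_nonneg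
  · refine le_csInf ⟨_, γ, hγ, rfl⟩ ?_
    rintro _ ⟨γ, hγ, rfl⟩
    exact hle γ hγ

end General

/-- Two triangles `0 1 2` and `3 4 5`, joined by the edges `0 3` and `0 4`. -/
def linkedTriangles : SimpleGraph (Fin 6) where
  Adj a b := (a, b) ∈ ({(0, 1), (1, 0), (0, 2), (2, 0), (1, 2), (2, 1), (3, 4), (4, 3), (3, 5),
    (5, 3), (4, 5), (5, 4), (0, 3), (3, 0), (0, 4), (4, 0)} : Finset (Fin 6 × Fin 6))
  symm := ⟨by decide⟩
  loopless := ⟨by decide⟩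

instance : DecidableRel linkedTriangles.Adj := fun a b => by
  unfold linkedTriangles
  infer_instance

/-- The disjoint union of `n` copies of `linkedTriangles`. -/
def linkedTrianglesCopies (n : ℕ) : SimpleGraph (Fin n × Fin 6) where
  Adj p q := p.1 = q.1 ∧ linkedTriangles.Adj p.2 q.2
  symm := ⟨fun _ _ h => ⟨h.1.symm, h.2.symm⟩⟩
  loopless := ⟨fun _ h => linkedTriangles.loopless.irrefl _ h.2⟩

instance (n : ℕ) : DecidableRel (linkedTrianglesCopies n).Adj := fun p q => by
  unfold linkedTrianglesCopies
  infer_instance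

/-- The fractional perfect matching of `linkedTriangles` with values `x` on the edge `0 3` and
`y` on the edge `0 4`. -/
noncomputable def linkedWeight (x y : ℝ) : Matrix (Fin 6) (Fin 6) ℝ :=
  !![0, (1 - x - y) / 2, (1 - x - y) / 2, x, y, 0;
    (1 - x - y) / 2, 0, (1 + x + y) / 2, 0, 0, 0;
    (1 - x - y) / 2, (1 + x + y) / 2, 0, 0, 0, 0;
    x, 0, 0, 0, (1 - x - y) / 2, (1 - x + y) / 2;
    y, 0, 0, (1 - x - y) / 2, 0, (1 + x - y) / 2;
    0, 0, 0, (1 - x + y) / 2, (1 + x - y) / 2, 0]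

theorem linkedWeight_comm (x y : ℝ) (a b : Fin 6) :
    linkedWeight x y a b = linkedWeight x y b a := by
  fin_cases a <;> fin_cases b <;> rfl

/-- The function on the edges of `linkedTrianglesCopies n` that is
`linkedWeight (x i) (y i)` on the `i`-th copy. -/
noncomputable def copiesWeight {n : ℕ} (x y : Fin n → ℝ) : Sym2 (Fin n × Fin 6) → ℝ :=
  Sym2.lift ⟨fun p q => if p.1 = q.1 then linkedWeight (x p.1) (y p.1) p.2 q.2 else 0, by
    rintro ⟨i, a⟩ ⟨j, b⟩
    by_cases h : i = j
    · subst h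
      simp [linkedWeight_comm (x i) (y i) a b]
    · simp [h, Ne.symm h]⟩

section Copies

variable {n : ℕ}

theorem copiesWeight_mk (x y : Fin n → ℝ) (p q : Fin n × Fin 6) :
    copiesWeight x y s(p, q) =
      if p.1 = q.1 then linkedWeight (x p.1) (y p.1) p.2 q.2 else 0 := rfl

theorem linkedWeight_eq_zero_of_not_adj (x y : ℝ) {a b : Fin 6}
    (h : ¬ linkedTriangles.Adj a b) : linkedWeight x y a b = 0 := by
  revert h
  fin_cases a <;> fin_cases b <;> first
    | exact fun _ => rfl
    | exact fun h => (h (by decide)).elim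

theorem linkedWeight_nonneg {x y : ℝ} (hx : 0 ≤ x) (hy : 0 ≤ y) (h : x + y ≤ 1) (a b : Fin 6) :
    0 ≤ linkedWeight x y a b := by
  fin_cases a <;> fin_cases b <;> simp [linkedWeight] <;> linarith

theorem vertexSum_copies (γ : Sym2 (Fin n × Fin 6) → ℝ) (i : Fin n) (a : Fin 6) :
    vertexSum (linkedTrianglesCopies n) γ (i, a) =
      ∑ b, if linkedTriangles.Adj a b then γ s((i, a), (i, b)) else 0 := by
  rw [vertexSum_eq_sum_adj, Fintype.sum_prod_type, Finset.sum_eq_single i]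
  · simp [linkedTrianglesCopies]
  · intro j _ hj
    simp [linkedTrianglesCopies, hj.symm]
  · simp

theorem vertexSum_copies_eqs (γ : Sym2 (Fin n × Fin 6) → ℝ) (i : Fin n) :
    vertexSum (linkedTrianglesCopies n) γ (i, 0) = γ s((i, 0), (i, 1)) + γ s((i, 0), (i, 2)) +
      γ s((i, 0), (i, 3)) + γ s((i, 0), (i, 4)) ∧
    vertexSum (linkedTrianglesCopies n) γ (i, 1) = γ s((i, 0), (i, 1)) + γ s((i, 1), (i, 2)) ∧
    vertexSum (linkedTrianglesCopies n) γ (i, 2) = γ s((i, 0), (i, 2)) + γ s((i, 1), (i, 2)) ∧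
    vertexSum (linkedTrianglesCopies n) γ (i, 3) = γ s((i, 0), (i, 3)) + γ s((i, 3), (i, 4)) +
      γ s((i, 3), (i, 5)) ∧
    vertexSum (linkedTrianglesCopies n) γ (i, 4) = γ s((i, 0), (i, 4)) + γ s((i, 3), (i, 4)) +
      γ s((i, 4), (i, 5)) ∧
    vertexSum (linkedTrianglesCopies n) γ (i, 5) = γ s((i, 3), (i, 5)) + γ s((i, 4), (i, 5)) := by
  have hswap (a b : Fin 6) : γ s((i, a), (i, b)) = γ s((i, b), (i, a)) := by rw [Sym2.eq_swap]
  simp only [vertexSum_copies, Fin.sum_univ_six]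
  refine ⟨?_, ?_, ?_, ?_, ?_, ?_⟩ <;> simp [linkedTriangles]
  · rw [hswap 1 0]
  · rw [hswap 2 0, hswap 2 1]
  · rw [hswap 3 0]
  · rw [hswap 4 0, hswap 4 3]
  · rw [hswap 5 3, hswap 5 4]

theorem eSum_copies (α : Sym2 (Fin n × Fin 6) → ℝ) :
    eSum (linkedTrianglesCopies n) α = ∑ i, (α s((i, 0), (i, 1)) + α s((i, 0), (i, 2)) +
      α s((i, 1), (i, 2)) + α s((i, 3), (i, 4)) + α s((i, 3), (i, 5)) + α s((i, 4), (i, 5)) +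
      α s((i, 0), (i, 3)) + α s((i, 0), (i, 4))) := by
  have h := sum_vertexSum (linkedTrianglesCopies n) α
  rw [Fintype.sum_prod_type] at h
  have h2 : 2 * eSum (linkedTrianglesCopies n) α = 2 * ∑ i, (α s((i, 0), (i, 1)) +
      α s((i, 0), (i, 2)) + α s((i, 1), (i, 2)) + α s((i, 3), (i, 4)) + α s((i, 3), (i, 5)) +
      α s((i, 4), (i, 5)) + α s((i, 0), (i, 3)) + α s((i, 0), (i, 4))) := by
    rw [← h, Finset.mul_sum]
    refine Finset.sum_congr rfl fun i _ => ?_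
    obtain ⟨h0, h1, h2, h3, h4, h5⟩ := vertexSum_copies_eqs α i
    rw [Fin.sum_univ_six, h0, h1, h2, h3, h4, h5]
    ring
  linarith

theorem isFPM_copiesWeight {x y : Fin n → ℝ} (hx : ∀ i, 0 ≤ x i) (hy : ∀ i, 0 ≤ y i)
    (h : ∀ i, x i + y i ≤ 1) : IsFPM (linkedTrianglesCopies n) (copiesWeight x y) := by
  refine ⟨fun e => ?_, fun e he => ?_, fun ⟨i, a⟩ => ?_⟩
  · induction e using Sym2.ind with
    | _ p q =>
      rw [copiesWeight_mk]
      split_ifs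
      · exact linkedWeight_nonneg (hx _) (hy _) (h _) _ _
      · exact le_rfl
  · induction e using Sym2.ind with
    | _ p q =>
      rw [copiesWeight_mk]
      split_ifs with hpq
      · exact linkedWeight_eq_zero_of_not_adj _ _ fun hadj => he ⟨hpq, hadj⟩
      · rfl
  · obtain ⟨h0, h1, h2, h3, h4, h5⟩ := vertexSum_copies_eqs (copiesWeight x y) i
    fin_cases a
    · refine h0.trans ?_
      simp [copiesWeight_mk, linkedWeight]
      ring
    · refine h1.trans ?_
      simp [copiesWeight_mk, linkedWeight]
      ring
    · refine h2.trans ?_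
      simp [copiesWeight_mk, linkedWeight]
      ring
    · refine h3.trans ?_
      simp [copiesWeight_mk, linkedWeight]
      ring
    · refine h4.trans ?_
      simp [copiesWeight_mk, linkedWeight]
      ring
    · refine h5.trans ?_
      simp [copiesWeight_mk, linkedWeight]
      ring

theorem rel_of_rel_copies {α β : Sym2 (Fin n × Fin 6) → ℝ} (R : ℝ → ℝ → Prop)
    (hoff : ∀ e ∉ (linkedTrianglesCopies n).edgeSet, R (α e) (β e))
    (h : ∀ i, R (α s((i, 0), (i, 1))) (β s((i, 0), (i, 1))) ∧
      R (α s((i, 0), (i, 2))) (β s((i, 0), (i, 2))) ∧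
      R (α s((i, 1), (i, 2))) (β s((i, 1), (i, 2))) ∧
      R (α s((i, 3), (i, 4))) (β s((i, 3), (i, 4))) ∧
      R (α s((i, 3), (i, 5))) (β s((i, 3), (i, 5))) ∧
      R (α s((i, 4), (i, 5))) (β s((i, 4), (i, 5))) ∧
      R (α s((i, 0), (i, 3))) (β s((i, 0), (i, 3))) ∧
      R (α s((i, 0), (i, 4))) (β s((i, 0), (i, 4)))) (e : Sym2 (Fin n × Fin 6)) :
    R (α e) (β e) := by
  by_cases he : e ∈ (linkedTrianglesCopies n).edgeSet
  · induction e using Sym2.ind with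
    | _ p q =>
      obtain ⟨i, a⟩ := p
      obtain ⟨j, b⟩ := q
      obtain ⟨rfl : i = j, hab⟩ := he
      obtain ⟨h1, h2, h3, h4, h5, h6, h7, h8⟩ := h i
      simp only [linkedTriangles, Finset.mem_insert, Finset.mem_singleton, Prod.mk.injEq] at hab
      rcases hab with ⟨rfl, rfl⟩ | ⟨rfl, rfl⟩ | ⟨rfl, rfl⟩ | ⟨rfl, rfl⟩ | ⟨rfl, rfl⟩ | ⟨rfl, rfl⟩ |
        ⟨rfl, rfl⟩ | ⟨rfl, rfl⟩ | ⟨rfl, rfl⟩ | ⟨rfl, rfl⟩ | ⟨rfl, rfl⟩ | ⟨rfl, rfl⟩ | ⟨rfl, rfl⟩ |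
        ⟨rfl, rfl⟩ | ⟨rfl, rfl⟩ | ⟨rfl, rfl⟩ <;>
      first
        | assumption
        | rw [Sym2.eq_swap]; assumption
  · exact hoff e he

theorem IsFPM.eq_copiesWeight {γ : Sym2 (Fin n × Fin 6) → ℝ}
    (hγ : IsFPM (linkedTrianglesCopies n) γ) :
    γ = copiesWeight (fun i => γ s((i, 0), (i, 3))) (fun i => γ s((i, 0), (i, 4))) := by
  ext e
  refine rel_of_rel_copies (· = ·) (fun e he => ?_) (fun i => ?_) e
  · rw [hγ.2.1 e he]
    induction e using Sym2.ind with
    | _ p q =>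
      rw [copiesWeight_mk]
      split_ifs with hpq
      · exact (linkedWeight_eq_zero_of_not_adj _ _ fun hadj => he ⟨hpq, hadj⟩).symm
      · rfl
  · obtain ⟨h0, h1, h2, h3, h4, h5⟩ := vertexSum_copies_eqs γ i
    rw [hγ.2.2] at h0 h1 h2 h3 h4 h5
    simp only [copiesWeight_mk, linkedWeight, if_true]
    refine ⟨?_, ?_, ?_, ?_, ?_, ?_, ?_, ?_⟩ <;> simp <;> linarith

theorem IsFPM.exists_eq_copiesWeight {γ : Sym2 (Fin n × Fin 6) → ℝ}
    (hγ : IsFPM (linkedTrianglesCopies n) γ) :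
    ∃ x y : Fin n → ℝ, (∀ i, 0 ≤ x i) ∧ (∀ i, 0 ≤ y i) ∧ (∀ i, x i + y i ≤ 1) ∧
      γ = copiesWeight x y := by
  refine ⟨_, _, fun i => hγ.1 _, fun i => hγ.1 _, fun i => ?_, hγ.eq_copiesWeight⟩
  obtain ⟨h0, -⟩ := vertexSum_copies_eqs γ i
  rw [hγ.2.2] at h0
  linarith [hγ.1 s((i, 0), (i, 1)), hγ.1 s((i, 0), (i, 2))]

theorem copiesWeight_left (x y : Fin n → ℝ) (i : Fin n) :
    copiesWeight x y s((i, 0), (i, 3)) = x i := by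
  simp [copiesWeight_mk, linkedWeight]

theorem copiesWeight_right (x y : Fin n → ℝ) (i : Fin n) :
    copiesWeight x y s((i, 0), (i, 4)) = y i := by
  simp [copiesWeight_mk, linkedWeight]

theorem copiesWeight_congr {x y x' y' : Fin n → ℝ} {e : Sym2 (Fin n × Fin 6)}
    (hx : x e.out.1.1 = x' e.out.1.1) (hy : y e.out.1.1 = y' e.out.1.1) :
    copiesWeight x y e = copiesWeight x' y' e := by
  have he : s(e.out.1, e.out.2) = e := Quot.out_eq e
  rw [← he, copiesWeight_mk, copiesWeight_mk, hx, hy]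

theorem half_le_eSum_of_isForcing {α γ : Sym2 (Fin n × Fin 6) → ℝ}
    (hγ : IsFPM (linkedTrianglesCopies n) γ) (hα : IsForcing (linkedTrianglesCopies n) α γ) :
    (n : ℝ) / 2 ≤ eSum (linkedTrianglesCopies n) α := by
  obtain ⟨x, y, hx, hy, hxy, rfl⟩ := hγ.exists_eq_copiesWeight
  obtain ⟨hα0, hαoff, hle, huniq⟩ := hα
  rw [eSum_copies]
  have hn : (n : ℝ) / 2 = ∑ _i : Fin n, (1 / 2 : ℝ) := by
    simp
    ring
  rw [hn]
  refine Finset.sum_le_sum fun i _ => ?_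
  by_contra! hlt
  have h1 := hα0 s((i, 0), (i, 1))
  have h2 := hα0 s((i, 0), (i, 2))
  have h3 := hα0 s((i, 1), (i, 2))
  have h4 := hα0 s((i, 3), (i, 4))
  have h5 := hα0 s((i, 3), (i, 5))
  have h6 := hα0 s((i, 4), (i, 5))
  have h7 := hα0 s((i, 0), (i, 3))
  have h8 := hα0 s((i, 0), (i, 4))
  set s := α s((i, 0), (i, 1)) + α s((i, 0), (i, 2)) +
      α s((i, 1), (i, 2)) + α s((i, 3), (i, 4)) + α s((i, 3), (i, 5)) + α s((i, 4), (i, 5)) +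
      α s((i, 0), (i, 3)) + α s((i, 0), (i, 4)) with hs
  -- Enlarging the weight of the edge `0 3` of the `i`-th copy by `δ` keeps it above `α`.
  have key (δ : ℝ) (hδ0 : 0 ≤ δ) (hδ : δ ≤ 1 - 2 * s) : α s((i, 0), (i, 3)) + δ = x i := by
    set x' := Function.update x i (α s((i, 0), (i, 3)) + δ)
    set y' := Function.update y i (α s((i, 0), (i, 4)))
    have hxi : x' i = α s((i, 0), (i, 3)) + δ := Function.update_self ..
    have hyi : y' i = α s((i, 0), (i, 4)) := Function.update_self ..
    have hxj (j) (hj : j ≠ i) : x' j = x j := Function.update_of_ne hj ..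
    have hyj (j) (hj : j ≠ i) : y' j = y j := Function.update_of_ne hj ..
    have hF : IsFPM (linkedTrianglesCopies n) (copiesWeight x' y') := by
      refine isFPM_copiesWeight (fun j => ?_) (fun j => ?_) (fun j => ?_) <;>
        rcases eq_or_ne j i with rfl | hj
      · linarith
      · rw [hxj j hj]
        exact hx j
      · linarith
      · rw [hyj j hj]
        exact hy j
      · linarith
      · rw [hxj j hj, hyj j hj]
        exact hxy j
    have hα' : α ≤ copiesWeight x' y' := by
      refine rel_of_rel_copies (· ≤ ·) (fun e he => ?_) (fun j => ?_)
      · rw [hαoff e he]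
        exact hF.1 e
      · rcases eq_or_ne j i with rfl | hj
        · simp only [copiesWeight_mk, linkedWeight, if_true]
          refine ⟨?_, ?_, ?_, ?_, ?_, ?_, ?_, ?_⟩ <;> simp <;> linarith
        · have h' (p q : Fin 6) : α s((j, p), (j, q)) ≤ copiesWeight x' y' s((j, p), (j, q)) := by
            refine (hle _).trans_eq ?_
            simp only [copiesWeight_mk, hxj j hj, hyj j hj]
          exact ⟨h' _ _, h' _ _, h' _ _, h' _ _, h' _ _, h' _ _, h' _ _, h' _ _⟩
    rw [← copiesWeight_left x y i, ← huniq _ hF hα', copiesWeight_left, hxi]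
  linarith [key 0 le_rfl (by linarith), key (1 - 2 * s) (by linarith) le_rfl]

theorem ffMin_linkedTrianglesCopies (n : ℕ) : ffMin (linkedTrianglesCopies n) = (n : ℝ) / 2 := by
  have hF : IsFPM (linkedTrianglesCopies n) (copiesWeight (fun _ => 0) (fun _ => 0)) :=
    isFPM_copiesWeight (fun _ => le_rfl) (fun _ => le_rfl) (fun _ => by norm_num)
  set S : Set (Sym2 (Fin n × Fin 6)) := Set.range fun i => s((i, 0), (i, 1))
  set α : Sym2 (Fin n × Fin 6) → ℝ := S.indicator fun _ => 1 / 2 with hα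
  have hmem (i : Fin n) : s((i, 0), (i, 1)) ∈ S := ⟨i, rfl⟩
  have hα0 (e) : 0 ≤ α e := Set.indicator_nonneg (fun _ _ => by norm_num) e
  have hnot (i : Fin n) {a b : Fin 6} (h : s(a, b) ≠ s(0, 1)) : s((i, a), (i, b)) ∉ S := by
    rintro ⟨j, hj⟩
    exact h (congrArg (Sym2.map Prod.snd) hj).symm
  refine ffMin_eq_of_forall hF (α := α) ⟨hα0, ?_, ?_, ?_⟩ ?_ fun _ _ => half_le_eSum_of_isForcing
  · intro e he
    refine Set.indicator_of_notMem ?_ _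
    rintro ⟨i, rfl⟩
    exact he ⟨rfl, show linkedTriangles.Adj 0 1 by decide⟩
  · intro e
    refine Set.indicator_apply_le' ?_ fun _ => hF.1 e
    rintro ⟨i, rfl⟩
    simp [copiesWeight_mk, linkedWeight]
  · intro γ' hγ' hle
    obtain ⟨x, y, hx, hy, -, rfl⟩ := hγ'.exists_eq_copiesWeight
    have h (i : Fin n) : x i = 0 ∧ y i = 0 := by
      have := hle s((i, 0), (i, 1))
      rw [hα, Set.indicator_of_mem (hmem i)] at this
      simp [copiesWeight_mk, linkedWeight] at this
      constructor <;> linarith [hx i, hy i]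
    congr 1
    · exact funext fun i => (h i).1
    · exact funext fun i => (h i).2
  · rw [eSum_copies, hα]
    refine le_of_eq ?_
    trans ∑ _i : Fin n, (1 / 2 : ℝ)
    · refine Finset.sum_congr rfl fun i _ => ?_
      rw [Set.indicator_of_mem (hmem i)]
      iterate 7 rw [Set.indicator_of_notMem (hnot i (by decide))]
      ring
    · simp
      ring

/-- The perfect matching of `linkedTrianglesCopies n` that links the two triangles of the `i`-th
copy by the edge `0 3` if `c i` is true, and by the edge `0 4` otherwise. -/
noncomputable def choiceWeight (c : Fin n → Bool) : Sym2 (Fin n × Fin 6) → ℝ :=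
  copiesWeight (fun i => if c i then 1 else 0) (fun i => if c i then 0 else 1)

theorem choiceWeight_injective :
    Function.Injective (choiceWeight : (Fin n → Bool) → Sym2 (Fin n × Fin 6) → ℝ) := by
  intro c d h
  ext i
  have := congrFun h s((i, 0), (i, 3))
  rw [choiceWeight, choiceWeight, copiesWeight_left, copiesWeight_left] at this
  by_cases hc : c i <;> by_cases hd : d i <;> simp_all

theorem choiceWeight_eq_zero_or_one (c : Fin n → Bool) (e : Sym2 (Fin n × Fin 6)) :
    choiceWeight c e = 0 ∨ choiceWeight c e = 1 := by
  induction e using Sym2.ind with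
  | _ p q =>
    obtain ⟨i, a⟩ := p
    obtain ⟨j, b⟩ := q
    rw [choiceWeight, copiesWeight_mk]
    by_cases hij : i = j
    · rw [if_pos hij]
      fin_cases a <;> fin_cases b <;> cases c i <;> norm_num [linkedWeight, Matrix.of_apply]
    · exact Or.inl (if_neg hij)

theorem exists_isPM_choiceWeight (c : Fin n → Bool) :
    ∃ M, IsPM (linkedTrianglesCopies n) M ∧ charF M = choiceWeight c := by
  have h : charF (univ.filter fun e => choiceWeight c e = 1) = choiceWeight c := by
    ext e
    rcases choiceWeight_eq_zero_or_one c e with he | he <;> simp [charF, he]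
  refine ⟨_, isPM_iff_isFPM_charF.2 ?_, h⟩
  rw [h]
  refine isFPM_copiesWeight (fun i => ?_) (fun i => ?_) (fun i => ?_) <;> split_ifs <;> norm_num

theorem IsPM.exists_choiceWeight {M : Finset (Sym2 (Fin n × Fin 6))}
    (hM : IsPM (linkedTrianglesCopies n) M) : ∃ c, charF M = choiceWeight c := by
  obtain ⟨x, y, hx, hy, -, h⟩ := (isPM_iff_isFPM_charF.1 hM).exists_eq_copiesWeight
  have h01 (e) : copiesWeight x y e = 0 ∨ copiesWeight x y e = 1 := by
    rw [← h, charF]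
    split_ifs <;> simp
  have hx01 (i) : x i = 0 ∨ x i = 1 := by
    simpa only [copiesWeight_left] using h01 s((i, 0), (i, 3))
  have hsum (i) : x i + y i = 1 := by
    have := h01 s((i, 1), (i, 2))
    simp [copiesWeight_mk, linkedWeight] at this
    rcases this with h | h <;> linarith [hx i, hy i]
  refine ⟨fun i => decide (x i = 1), ?_⟩
  rw [h, choiceWeight]
  congr 1 <;> ext i <;> rcases hx01 i with hi | hi <;> simp [hi] <;> linarith [hsum i]

theorem fMin_linkedTrianglesCopies (n : ℕ) : fMin (linkedTrianglesCopies n) = n := by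
  obtain ⟨M, hM, hMc⟩ := exists_isPM_choiceWeight fun _ : Fin n => true
  refine fMin_eq_of_forall (M := M) (S := univ.image fun i : Fin n => s((i, 0), (i, 3))) hM
    ⟨?_, fun M' hM' hS => ?_⟩ (Finset.card_image_le.trans (by simp)) ?_
  · rw [subset_iff_charF, hMc]
    simp [choiceWeight, copiesWeight_left]
  · obtain ⟨c, hc⟩ := hM'.exists_choiceWeight
    rw [subset_iff_charF, hc] at hS
    refine charF_injective_s8 (hc.trans (Eq.trans ?_ hMc.symm))
    congr 1
    ext i
    have := hS s((i, 0), (i, 3)) (Finset.mem_image_of_mem _ (Finset.mem_univ i))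
    rw [choiceWeight, copiesWeight_left] at this
    by_contra hci
    simp_all
  · intro M S hM hS
    obtain ⟨c, hc⟩ := hM.exists_choiceWeight
    have himage : S.image (fun e => e.out.1.1) = univ := by
      refine Finset.eq_univ_of_forall fun i => ?_
      by_contra hi
      have hne (e) (he : e ∈ S) : e.out.1.1 ≠ i := fun h =>
        hi (Finset.mem_image.2 ⟨e, he, h⟩)
      obtain ⟨M', hM', hc'⟩ := exists_isPM_choiceWeight (Function.update c i (!c i))
      have hSM := subset_iff_charF.1 hS.1
      have hM'M : M' = M := by
        refine hS.2 M' hM' (subset_iff_charF.2 fun e he => ?_)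
        rw [← hSM e he, hc, hc', choiceWeight, choiceWeight]
        apply copiesWeight_congr <;> simp only [Function.update_of_ne (hne e he)]
      have := congrFun (choiceWeight_injective (hc'.symm.trans (hM'M ▸ hc))) i
      simp at this
    calc n = (univ : Finset (Fin n)).card := by simp
      _ ≤ S.card := himage ▸ Finset.card_image_le

theorem exists_isPM_linkedTrianglesCopies (n : ℕ) : ∃ M, IsPM (linkedTrianglesCopies n) M :=
  (exists_isPM_choiceWeight fun _ => true).imp fun _ h => h.1

end Copies

/-- For every nonnegative integer `s` there is a graph with a perfect matching whose
forcing number exceeds its fractional forcing number by exactly `s`, and one where the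
difference is exactly `s + 1/2`. -/
theorem exists_graph_forcing_gap (s : ℕ) :
    (∃ (W : Type) (_ : Fintype W) (_ : DecidableEq W) (G : SimpleGraph W)
        (_ : DecidableRel G.Adj),
        (∃ M, IsPM G M) ∧ (fMin G : ℝ) - ffMin G = (s : ℝ)) ∧
    (∃ (W : Type) (_ : Fintype W) (_ : DecidableEq W) (G' : SimpleGraph W)
        (_ : DecidableRel G'.Adj),
        (∃ M, IsPM G' M) ∧ (fMin G' : ℝ) - ffMin G' = (s : ℝ) + 1 / 2) := by
  constructor
  · refine ⟨_, inferInstance, inferInstance, linkedTrianglesCopies (2 * s), inferInstance,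
      exists_isPM_linkedTrianglesCopies _, ?_⟩
    rw [fMin_linkedTrianglesCopies, ffMin_linkedTrianglesCopies]
    push_cast
    ring
  · refine ⟨_, inferInstance, inferInstance, linkedTrianglesCopies (2 * s + 1), inferInstance,
      exists_isPM_linkedTrianglesCopies _, ?_⟩
    rw [fMin_linkedTrianglesCopies, ffMin_linkedTrianglesCopies]
    push_cast
    ring
end

section
/- Let G be a finite simple graph, γ₁ and γ₂ fractional perfect matchings of G, α₁ a minimal forcing function for γ₁ (α₁ ⇑ γ₁), and ε > 0 with d(γ₁, γ₂) < ε, where d(γ₁,γ₂) = Σ_{e∈E(G)} |γ₁(e) − γ₂(e)|. Then there exists a nonnegative function α₂ with α₂ ↑ γ₂ and |Σ_{e∈E(G)} α₁(e) − Σ_{e∈E(G)} α₂(e)| < ε. -/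
open Finset

variable {V : Type} [Fintype V] [DecidableEq V]

/-- Fractional perfect matchings are stable under adding a multiple of the difference of two of
them, as long as the result is nonnegative. -/
lemma IsFPM.add_smul_sub {G : SimpleGraph V} [DecidableRel G.Adj] {γ γ₁ γ₂ : Sym2 V → ℝ}
    (hγ : IsFPM G γ) (hγ₁ : IsFPM G γ₁) (hγ₂ : IsFPM G γ₂) {t : ℝ}
    (h : ∀ e, 0 ≤ γ e + t * (γ₁ e - γ₂ e)) :
    IsFPM G (fun e => γ e + t * (γ₁ e - γ₂ e)) := by
  refine ⟨h, fun e he => by simp [hγ.2.1 e he, hγ₁.2.1 e he, hγ₂.2.1 e he], fun v => ?_⟩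
  have key : vertexSum G (fun e => γ e + t * (γ₁ e - γ₂ e)) v =
      vertexSum G γ v + t * (vertexSum G γ₁ v - vertexSum G γ₂ v) := by
    simp only [vertexSum, ← Finset.sum_sub_distrib, Finset.mul_sum, ← Finset.sum_add_distrib]
    refine Finset.sum_congr rfl fun e _ => ?_
    split_ifs <;> ring
  rw [key, hγ.2.2, hγ₁.2.2, hγ₂.2.2]
  ring

/-- A pointwise inequality on a finite type survives a small perturbation that is nonnegative
wherever the inequality is an equality. -/
lemma exists_pos_forall_le_add_mul {ι : Type*} [Finite ι] {a b δ : ι → ℝ} (hab : a ≤ b)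
    (hδ : ∀ i, a i = b i → 0 ≤ δ i) : ∃ t > 0, ∀ i, a i ≤ b i + t * δ i := by
  have hev : ∀ᶠ t : ℝ in nhdsWithin 0 (Set.Ioi 0), ∀ i, a i ≤ b i + t * δ i := by
    rw [Filter.eventually_all]
    intro i
    rcases (hab i).eq_or_lt with h | h
    · filter_upwards [self_mem_nhdsWithin] with t ht
      have := mul_nonneg (le_of_lt ht) (hδ i h)
      linarith
    · have hc : ContinuousAt (fun t : ℝ => b i + t * δ i) 0 := by fun_prop
      have := hc.eventually (lt_mem_nhds (a := a i) (by simpa using h))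
      exact (this.filter_mono nhdsWithin_le_nhds).mono fun _ => le_of_lt
  obtain ⟨t, ht, ht0⟩ := (hev.and self_mem_nhdsWithin).exists
  exact ⟨t, ht0, ht⟩

/-- Whether a function forces a fractional perfect matching depends only on the set of edges where
the two agree: this set can be transferred to any other fractional perfect matching. -/
lemma IsForcing.transfer {G : SimpleGraph V} [DecidableRel G.Adj] {α γ γ₂ : Sym2 V → ℝ}
    (hα : IsForcing G α γ) (hγ : IsFPM G γ) (hγ₂ : IsFPM G γ₂) :
    IsForcing G (fun e => if α e = γ e then γ₂ e else 0) γ₂ := by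
  refine ⟨fun e => ?_, fun e he => ?_, fun e => ?_, fun γ' hγ' hle => ?_⟩
  · dsimp only
    split_ifs
    exacts [hγ₂.1 e, le_rfl]
  · simp [hγ₂.2.1 e he]
  · dsimp only
    split_ifs
    exacts [le_rfl, hγ₂.1 e]
  · obtain ⟨t, ht, hat⟩ := exists_pos_forall_le_add_mul (δ := fun e => γ' e - γ₂ e) hα.2.2.1
      fun e he => by simpa [he] using hle e
    have heq := hα.2.2.2 _
      (hγ.add_smul_sub hγ' hγ₂ fun e => (hα.1 e).trans (hat e)) hat
    funext e
    have h := congrFun heq e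
    simpa [ht.ne', sub_eq_zero] using h

/-- A minimal forcing function agrees with the matching it forces wherever it does not vanish. -/
lemma IsMinForcing.eq_ite {G : SimpleGraph V} [DecidableRel G.Adj] {α γ : Sym2 V → ℝ}
    (hα : IsMinForcing G α γ) (hγ : IsFPM G γ) :
    (fun e => if α e = γ e then γ e else 0) = α := by
  have hf := hα.1.transfer hγ hγ
  refine hα.2 _ hf.1 (fun e => ?_) hf
  dsimp only
  split_ifs with h
  exacts [h.ge, hα.1.1 e]

/-- If `α₁ ⇑ γ₁` and `d(γ₁,γ₂) < ε`, then there is a forcing function `α₂ ↑ γ₂` with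
`| |α₁| - |α₂| | < ε`. -/
theorem exists_close_forcing (G : SimpleGraph V) [DecidableRel G.Adj]
    (γ₁ γ₂ : Sym2 V → ℝ) (hγ₁ : IsFPM G γ₁) (hγ₂ : IsFPM G γ₂)
    (α₁ : Sym2 V → ℝ) (hα₁ : IsMinForcing G α₁ γ₁)
    (ε : ℝ) (hε : 0 < ε) (hd : ∑ e ∈ G.edgeFinset, |γ₁ e - γ₂ e| < ε) :
    ∃ α₂, IsForcing G α₂ γ₂ ∧ |eSum G α₁ - eSum G α₂| < ε := by
  refine ⟨_, hα₁.1.transfer hγ₁ hγ₂, lt_of_le_of_lt ?_ hd⟩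
  rw [eSum, eSum, ← Finset.sum_sub_distrib]
  refine (Finset.abs_sum_le_sum_abs _ _).trans (Finset.sum_le_sum fun e _ => ?_)
  have he := congrFun (hα₁.eq_ite hγ₁) e
  split_ifs at he ⊢ with h
  · rw [h]
  · simp [← he]
end

section
/- Let G be a finite simple graph having at least one fractional perfect matching. Then spec_f(G) = [f_f(G), F_f(G)], i.e., the set of values {f_f(G,γ) : γ ∈ P_f(G)} equals the closed real interval from f_f(G) = min_{γ∈P_f(G)} f_f(G,γ) to F_f(G) = max_{γ∈P_f(G)} f_f(G,γ). -/
open Finset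

variable {V : Type} [Fintype V] [DecidableEq V]

open Filter Topology

theorem vertexSum_add (G : SimpleGraph V) [DecidableRel G.Adj] (γ δ : Sym2 V → ℝ) (v : V) :
    vertexSum G (γ + δ) v = vertexSum G γ v + vertexSum G δ v := by
  simp only [vertexSum, ← Finset.sum_add_distrib, Pi.add_apply]
  refine Finset.sum_congr rfl fun e _ => ?_
  split_ifs <;> simp

theorem vertexSum_smul (G : SimpleGraph V) [DecidableRel G.Adj] (c : ℝ) (γ : Sym2 V → ℝ) (v : V) :
    vertexSum G (c • γ) v = c * vertexSum G γ v := by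
  simp only [vertexSum, Finset.mul_sum, Pi.smul_apply, smul_eq_mul, mul_ite, mul_zero]

theorem continuous_vertexSum (G : SimpleGraph V) [DecidableRel G.Adj] (v : V) :
    Continuous fun γ : Sym2 V → ℝ => vertexSum G γ v := by
  unfold vertexSum
  refine continuous_finsetSum _ fun e _ => ?_
  split_ifs <;> fun_prop

theorem exists_le_vertexSum (G : SimpleGraph V) [DecidableRel G.Adj] {γ : Sym2 V → ℝ}
    (h : ∀ e ∈ G.edgeSet, 0 ≤ γ e) {e : Sym2 V} (he : e ∈ G.edgeSet) :
    ∃ v, γ e ≤ vertexSum G γ v := by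
  obtain ⟨v, hv⟩ : ∃ v, v ∈ e := ⟨_, Sym2.out_fst_mem e⟩
  refine ⟨v, ?_⟩
  have := Finset.single_le_sum (f := fun e => if v ∈ e then γ e else 0) (s := G.edgeFinset)
    (fun i hi => by
      split_ifs
      · exact h i (SimpleGraph.mem_edgeFinset.1 hi)
      · exact le_rfl) (SimpleGraph.mem_edgeFinset.2 he)
  simpa [vertexSum, hv] using this

theorem IsFPM.le_one {G : SimpleGraph V} [DecidableRel G.Adj] {γ : Sym2 V → ℝ}
    (h : IsFPM G γ) (e : Sym2 V) : γ e ≤ 1 := by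
  by_cases he : e ∈ G.edgeSet
  · obtain ⟨v, hv⟩ := exists_le_vertexSum G (fun e _ => h.1 e) he
    exact hv.trans (h.2.2 v).le
  · simp [h.2.1 e he]

theorem isClosed_setOf_isFPM (G : SimpleGraph V) [DecidableRel G.Adj] :
    IsClosed {γ | IsFPM G γ} := by
  simp only [IsFPM, Set.ofPred_and, Set.ofPred_forall]
  refine IsClosed.inter ?_ (IsClosed.inter ?_ ?_)
  · exact isClosed_iInter fun e => isClosed_le continuous_const (continuous_apply e)
  · exact isClosed_iInter fun e => isClosed_iInter fun _ =>
      isClosed_eq (continuous_apply e) continuous_const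
  · exact isClosed_iInter fun v => isClosed_eq (continuous_vertexSum G v) continuous_const

theorem isCompact_setOf_isFPM (G : SimpleGraph V) [DecidableRel G.Adj] :
    IsCompact {γ | IsFPM G γ} :=
  isCompact_Icc.of_isClosed_subset (isClosed_setOf_isFPM G)
    fun _ (h : IsFPM G _) => (⟨h.1, h.le_one⟩ : _ ∈ Set.Icc (0 : Sym2 V → ℝ) 1)

theorem convex_setOf_isFPM (G : SimpleGraph V) [DecidableRel G.Adj] :
    Convex ℝ {γ | IsFPM G γ} := by
  rintro γ ⟨hγ₁, hγ₂, hγ₃⟩ δ ⟨hδ₁, hδ₂, hδ₃⟩ a b ha hb hab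
  refine ⟨fun e => ?_, fun e he => ?_, fun v => ?_⟩
  · exact add_nonneg (mul_nonneg ha (hγ₁ e)) (mul_nonneg hb (hδ₁ e))
  · simp [hγ₂ e he, hδ₂ e he]
  · simp [vertexSum_add, vertexSum_smul, hγ₃, hδ₃, hab]

/-- A set `Z` of edges is rigid if every function on the edges that has zero sum at each vertex
and is nonnegative on `Z` vanishes identically. -/
def IsRigid (G : SimpleGraph V) [DecidableRel G.Adj] (Z : Finset (Sym2 V)) : Prop :=
  ∀ δ : Sym2 V → ℝ, (∀ e ∉ G.edgeSet, δ e = 0) → (∀ v, vertexSum G δ v = 0) →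
    (∀ e ∈ Z, 0 ≤ δ e) → δ = 0

theorem isRigid_edgeFinset (G : SimpleGraph V) [DecidableRel G.Adj] :
    IsRigid G G.edgeFinset := by
  intro δ h₁ h₂ h₃
  ext e
  by_cases he : e ∈ G.edgeSet
  · obtain ⟨v, hv⟩ :=
      exists_le_vertexSum G (fun e he => h₃ e (SimpleGraph.mem_edgeFinset.2 he)) he
    exact le_antisymm (hv.trans (h₂ v).le) (h₃ e (SimpleGraph.mem_edgeFinset.2 he))
  · exact h₁ e he

theorem IsRigid.isForcing {G : SimpleGraph V} [DecidableRel G.Adj] {Z : Finset (Sym2 V)}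
    (hZ : IsRigid G Z) {γ : Sym2 V → ℝ} (hγ : IsFPM G γ) :
    IsForcing G (fun e => if e ∈ Z then γ e else 0) γ := by
  refine ⟨fun e => ?_, fun e he => ?_, fun e => ?_, fun γ' hγ' hle => ?_⟩
  · dsimp only
    split_ifs
    exacts [hγ.1 e, le_rfl]
  · simp [hγ.2.1 e he]
  · dsimp only
    split_ifs
    exacts [le_rfl, hγ.1 e]
  · have h := hZ (γ' + (-1 : ℝ) • γ) (fun e he => by simp [hγ.2.1 e he, hγ'.2.1 e he])
      (fun v => by simp only [vertexSum_add, vertexSum_smul, hγ.2.2, hγ'.2.2]; norm_num)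
      (fun e he => by simpa [he] using hle e)
    rw [neg_one_smul, ← sub_eq_add_neg] at h
    exact sub_eq_zero.1 h

theorem IsForcing.isRigid {G : SimpleGraph V} [DecidableRel G.Adj] {α γ : Sym2 V → ℝ}
    (h : IsForcing G α γ) (hγ : IsFPM G γ) :
    IsRigid G (G.edgeFinset.filter fun e => α e = γ e) := by
  intro δ h₁ h₂ h₃
  have hev : ∀ᶠ ε : ℝ in 𝓝[>] 0, ∀ e, α e ≤ γ e + ε * δ e := by
    refine eventually_all.2 fun e => ?_
    rcases (h.2.2.1 e).eq_or_lt with heq | hlt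
    · filter_upwards [self_mem_nhdsWithin] with ε hε
      have hδ : 0 ≤ δ e := by
        by_cases he : e ∈ G.edgeSet
        · exact h₃ e (Finset.mem_filter.2 ⟨SimpleGraph.mem_edgeFinset.2 he, heq⟩)
        · exact (h₁ e he).ge
      exact heq.le.trans (le_add_of_nonneg_right (mul_nonneg (le_of_lt hε) hδ))
    · have hc : Continuous fun ε : ℝ => γ e + ε * δ e := by fun_prop
      have ht := hc.tendsto 0
      rw [zero_mul, add_zero] at ht
      exact ((ht.eventually_const_lt hlt).filter_mono nhdsWithin_le_nhds).mono fun _ => le_of_lt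
  obtain ⟨ε, hle, hε⟩ := (hev.and self_mem_nhdsWithin).exists
  have heq := h.2.2.2 (γ + ε • δ)
    ⟨fun e => (h.1 e).trans (hle e), fun e he => by simp [hγ.2.1 e he, h₁ e he],
      fun v => by simp [vertexSum_add, vertexSum_smul, hγ.2.2, h₂]⟩ hle
  exact (smul_eq_zero.1 (add_eq_left.1 heq)).resolve_left (ne_of_gt hε)

open Classical in
/-- The rigid sets of edges of `G`. -/
noncomputable def rigidSets (G : SimpleGraph V) [DecidableRel G.Adj] : Finset (Finset (Sym2 V)) :=
  G.edgeFinset.powerset.filter (IsRigid G)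

theorem mem_rigidSets {G : SimpleGraph V} [DecidableRel G.Adj] {Z : Finset (Sym2 V)} :
    Z ∈ rigidSets G ↔ Z ⊆ G.edgeFinset ∧ IsRigid G Z := by
  simp [rigidSets]

theorem rigidSets_nonempty (G : SimpleGraph V) [DecidableRel G.Adj] : (rigidSets G).Nonempty :=
  ⟨_, mem_rigidSets.2 ⟨subset_rfl, isRigid_edgeFinset G⟩⟩

/-- The fractional forcing number is a minimum of linear functions, one for each rigid set. -/
theorem ffN_eq_inf' {G : SimpleGraph V} [DecidableRel G.Adj] {γ : Sym2 V → ℝ} (hγ : IsFPM G γ) :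
    ffN G γ = (rigidSets G).inf' (rigidSets_nonempty G) fun Z => ∑ e ∈ Z, γ e := by
  refine IsLeast.csInf_eq ⟨?_, ?_⟩
  · obtain ⟨Z, hZ, hmin⟩ :=
      Finset.exists_mem_eq_inf' (rigidSets_nonempty G) fun Z => ∑ e ∈ Z, γ e
    obtain ⟨hsub, hrigid⟩ := mem_rigidSets.1 hZ
    refine ⟨_, hrigid.isForcing hγ, ?_⟩
    rw [hmin, eSum, Finset.sum_ite_mem, Finset.inter_eq_right.2 hsub]
  · rintro x ⟨α, hα, rfl⟩
    refine (Finset.inf'_le _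
      (mem_rigidSets.2 ⟨Finset.filter_subset _ _, hα.isRigid hγ⟩)).trans ?_
    calc ∑ e ∈ G.edgeFinset with α e = γ e, γ e
        = ∑ e ∈ G.edgeFinset with α e = γ e, α e :=
          Finset.sum_congr rfl fun e he => (Finset.mem_filter.1 he).2.symm
      _ ≤ eSum G α :=
          Finset.sum_le_sum_of_subset_of_nonneg (Finset.filter_subset _ _) fun e _ _ => hα.1 e

theorem continuousOn_ffN (G : SimpleGraph V) [DecidableRel G.Adj] :
    ContinuousOn (ffN G) {γ | IsFPM G γ} := by
  have hc : Continuous fun γ : Sym2 V → ℝ =>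
      (rigidSets G).inf' (rigidSets_nonempty G) fun Z => ∑ e ∈ Z, γ e :=
    Continuous.finset_inf'_apply _ fun Z _ => by fun_prop
  exact hc.continuousOn.congr fun γ hγ => ffN_eq_inf' hγ

/-- `spec_f(G) = [f_f(G), F_f(G)]`. -/
theorem specf_eq_Icc (G : SimpleGraph V) [DecidableRel G.Adj]
    (hne : ∃ γ, IsFPM G γ) :
    {x : ℝ | ∃ γ, IsFPM G γ ∧ ffN G γ = x} = Set.Icc (ffMin G) (ffMax G) :=
  eq_Icc_of_connected_compact
    (IsConnected.image ⟨hne, (convex_setOf_isFPM G).isPreconnected⟩ _ (continuousOn_ffN G))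
    ((isCompact_setOf_isFPM G).image_of_continuousOn (continuousOn_ffN G))
end
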